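/- Let T be a tournament on n vertices and let k, t be positive integers with t ≥ 2. If T is strongly 10^7·k^6·t^3·log(k·t^2)-connected, then there exists a partition of V(T) into t vertex classes V_1, …, V_t such that for every i ∈ {1, …, t} the subtournament T[V_i] is strongly k-connected. -/

import Mathlib

/-!
Common definitions: tournaments as irreflexive, asymmetric, total relations on a
finite vertex type; reachability/strong connectivity inside induced subtournaments;
directed paths and cycles as lists of vertices; linkedness; transitivity; domination.
All logarithms are base 2 (`Real.logb 2`).
-/

variable {V : Type*}

/-- `adj` is (the edge relation of) a tournament on `V`. -/
def IsTournament (adj : V → V → Prop) : Prop :=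
  (∀ v, ¬ adj v v) ∧ (∀ u v, adj u v → ¬ adj v u) ∧ (∀ u v, u ≠ v → adj u v ∨ adj v u)

/-- There is a directed path (possibly trivial) from `x` to `y` inside the induced
subtournament on `U`. -/
def ReachIn (adj : V → V → Prop) (U : Set V) (x y : V) : Prop :=
  Relation.ReflTransGen (fun a b => a ∈ U ∧ b ∈ U ∧ adj a b) x y

/-- The induced subtournament on `U` is strongly connected. -/
def StrConnOn (adj : V → V → Prop) (U : Set V) : Prop :=
  ∀ x ∈ U, ∀ y ∈ U, ReachIn adj U x y

/-- The induced subtournament on `U` is strongly `k`-connected: it has more than `k`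
vertices and removing any fewer than `k` vertices leaves it strongly connected. -/
def StrKConnOn (adj : V → V → Prop) (k : ℕ) (U : Set V) : Prop :=
  k < U.ncard ∧ ∀ S : Set V, S ⊆ U → S.ncard < k → StrConnOn adj (U \ S)

/-- The tournament is strongly `r`-connected for a real parameter `r`:
it has more than `r` vertices, and removal of any set of fewer than `r` vertices
leaves a strongly connected tournament. -/
def StrConnR [Fintype V] (adj : V → V → Prop) (r : ℝ) : Prop :=
  r < (Fintype.card V : ℝ) ∧ ∀ S : Set V, (S.ncard : ℝ) < r → StrConnOn adj (Set.univ \ S)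

/-- A directed path, recorded as its (nonempty, duplicate-free) list of vertices,
consecutive ones joined by edges. -/
def IsPathList (adj : V → V → Prop) (p : List V) : Prop :=
  p ≠ [] ∧ p.Nodup ∧ p.Chain' adj

/-- `p` is a directed path from `x` to `y`. -/
def PathFromTo (adj : V → V → Prop) (p : List V) (x y : V) : Prop :=
  IsPathList adj p ∧ p.head? = some x ∧ p.getLast? = some y

/-- The interior (internal vertices) of a path given as a list. -/
def Interior (p : List V) : List V := p.tail.dropLast

/-- A directed cycle, recorded as a duplicate-free list of at least 3 vertices,
consecutive ones joined by edges, and an edge from the last vertex back to the first. -/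
def IsCycleList (adj : V → V → Prop) (p : List V) : Prop :=
  3 ≤ p.length ∧ p.Nodup ∧ p.Chain' adj ∧ ∀ h : p ≠ [], adj (p.getLast h) (p.head h)

/-- A tournament is `k`-linked if it has at least `2k` vertices and any `2k` distinct
vertices `x₁,…,x_k,y₁,…,y_k` can be joined by vertex-disjoint directed paths
`Pᵢ : xᵢ → yᵢ`. -/
def KLinked [Fintype V] (adj : V → V → Prop) (k : ℕ) : Prop :=
  2 * k ≤ Fintype.card V ∧
    ∀ x y : Fin k → V, Function.Injective (Sum.elim x y) →
      ∃ P : Fin k → List V,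
        (∀ i, PathFromTo adj (P i) (x i) (y i)) ∧
        ∀ i j, i ≠ j → ∀ v ∈ P i, v ∉ P j

/-- The list `l` enumerates a transitive tournament: `l[i] → l[j]` iff `i < j`. -/
def TransList (adj : V → V → Prop) (l : List V) : Prop :=
  ∀ i j : Fin l.length, adj (l.get i) (l.get j) ↔ (i : ℕ) < (j : ℕ)

/-- The induced subtournament on `A` is transitive. -/
def IsTransSet (adj : V → V → Prop) (A : Set V) : Prop :=
  ∃ l : List V, l.Nodup ∧ (∀ x, x ∈ l ↔ x ∈ A) ∧ TransList adj l

/-- The induced subtournament on `A` is transitive with sink `v`. -/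
def IsTransSetSink (adj : V → V → Prop) (A : Set V) (v : V) : Prop :=
  ∃ l : List V, l.Nodup ∧ (∀ x, x ∈ l ↔ x ∈ A) ∧ TransList adj l ∧ l.getLast? = some v

/-- The induced subtournament on `A` is transitive with source `v`. -/
def IsTransSetSource (adj : V → V → Prop) (A : Set V) (v : V) : Prop :=
  ∃ l : List V, l.Nodup ∧ (∀ x, x ∈ l ↔ x ∈ A) ∧ TransList adj l ∧ l.head? = some v

/-- `A` out-dominates `B`: every `b ∈ B` receives an edge from some `a ∈ A`. -/
def OutDominates (adj : V → V → Prop) (A B : Set V) : Prop := ∀ b ∈ B, ∃ a ∈ A, adj a b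

/-- `A` in-dominates `B`: every `b ∈ B` sends an edge to some `a ∈ A`. -/
def InDominates (adj : V → V → Prop) (A B : Set V) : Prop := ∀ b ∈ B, ∃ a ∈ A, adj b a

/-- The list `l` enumerates a backwards-transitive path:
`l[i] → l[j]` iff `j = i + 1` or `i ≥ j + 2`. -/
def BackTransList (adj : V → V → Prop) (l : List V) : Prop :=
  ∀ i j : Fin l.length,
    adj (l.get i) (l.get j) ↔ ((j : ℕ) = (i : ℕ) + 1 ∨ (j : ℕ) + 2 ≤ (i : ℕ))

/-- The induced subtournament on `Q` is a backwards-transitive path. -/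
def IsBackTransPathSet (adj : V → V → Prop) (Q : Set V) : Prop :=
  ∃ l : List V, l ≠ [] ∧ l.Nodup ∧ (∀ x, x ∈ l ↔ x ∈ Q) ∧ BackTransList adj l

/-- The ordered pair `(x, y)` is `k`-connected in the induced subtournament on `U`:
after deleting any fewer than `k` vertices of `U` other than `x, y`,
there still is a directed path from `x` to `y`. -/
def KConnPair (adj : V → V → Prop) (U : Set V) (k : ℕ) (x y : V) : Prop :=
  ∀ S : Set V, S ⊆ U \ {x, y} → S.ncard < k → ReachIn adj (U \ S) x y

namespace TP
section
open Classical

variable [Fintype V]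

noncomputable def oN (adj : V → V → Prop) (v : V) : Finset V :=
  Finset.univ.filter (fun u => adj v u)

lemma mem_oN (adj : V → V → Prop) (u v : V) : u ∈ oN adj v ↔ adj v u := by simp [oN]

lemma flipT {V : Type*} {adj : V → V → Prop} (hT : IsTournament adj) : IsTournament (flip adj) :=
  ⟨fun v => hT.1 v, fun u v h => hT.2.1 v u h, fun u v h => (hT.2.2 u v h).symm⟩

lemma exists_half {adj : V → V → Prop} (hT : IsTournament adj) (E : Finset V) (hE : E.Nonempty) :
    ∃ v ∈ E, 2 * (E.filter (fun u => adj v u)).card ≤ E.card := by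
  by_contra hcon
  push Not at hcon
  have h1 : ∑ v ∈ E, E.card < ∑ v ∈ E, 2 * (E.filter (fun u => adj v u)).card :=
    Finset.sum_lt_sum_of_nonempty hE hcon
  have h2 : ∑ v ∈ E, (E.filter (fun u => adj v u)).card
      = ∑ v ∈ E, (E.filter (fun u => adj u v)).card := by
    have := Finset.sum_card_bipartiteAbove_eq_sum_card_bipartiteBelow (s := E) (t := E) adj
    simpa [Finset.bipartiteAbove, Finset.bipartiteBelow] using this
  have h3 : ∀ v ∈ E, (E.filter (fun u => adj v u)).card + (E.filter (fun u => adj u v)).card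
      ≤ E.card := by
    intro v _
    rw [← Finset.card_union_of_disjoint]
    · apply Finset.card_le_card
      intro u hu
      simp only [Finset.mem_union, Finset.mem_filter] at hu
      tauto
    · rw [Finset.disjoint_left]
      intro u hu hu'
      simp only [Finset.mem_filter] at hu hu'
      exact hT.2.1 _ _ hu.2 hu'.2
  have h4 := Finset.sum_le_sum h3
  rw [Finset.sum_add_distrib, ← h2] at h4
  rw [← Finset.mul_sum] at h1
  omega

lemma dom {adj : V → V → Prop} (hT : IsTournament adj) (x : V) (U : Finset V) (c : ℕ) :
    ∃ (S E : Finset V) (a : V), S.card ≤ c ∧ Disjoint S U ∧ a ∈ insert x S ∧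
      (∀ u ∈ insert x S, u = a ∨ adj u a) ∧ 2 ^ c * E.card ≤ (oN adj x).card ∧
      (∀ v, v ∉ insert x S → v ∉ E → v ∉ U → ∃ u ∈ insert x S, adj v u) := by
  suffices h : ∃ (S E : Finset V) (a : V), S.card ≤ c ∧ Disjoint S U ∧ a ∈ insert x S ∧
      (∀ u ∈ insert x S, u = a ∨ adj u a) ∧ 2 ^ c * E.card ≤ (oN adj x).card ∧
      (∀ v, v ∉ insert x S → v ∉ E → v ∉ U → ∃ u ∈ insert x S, adj v u) ∧
      (∀ v ∈ E, v ∉ U ∧ ∀ u ∈ insert x S, adj u v) by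
    obtain ⟨S, E, a, h1, h2, h3, h4, h5, h6, _⟩ := h
    exact ⟨S, E, a, h1, h2, h3, h4, h5, h6⟩
  induction c with
  | zero =>
    refine ⟨∅, oN adj x \ U, x, by simp, by simp, by simp, by simp, ?_, ?_, ?_⟩
    · simpa using Finset.card_le_card Finset.sdiff_subset
    · intro v hv hE hU
      refine ⟨x, by simp, ?_⟩
      have hne : v ≠ x := by simpa using hv
      rcases hT.2.2 v x hne with h | h
      · exact h
      · exact absurd (by simp [mem_oN, h, hU]) hE
    · intro v hv
      simp only [Finset.mem_sdiff, mem_oN] at hv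
      simpa using ⟨hv.2, hv.1⟩
  | succ c ih =>
    obtain ⟨S, E, a, h1, h2, h3, h4, h5, h6, h7⟩ := ih
    rcases E.eq_empty_or_nonempty with hE | hE
    · subst hE
      exact ⟨S, ∅, a, by omega, h2, h3, h4, by simp, h6, by simp⟩
    · obtain ⟨v0, hv0, hh⟩ := exists_half hT E hE
      refine ⟨insert v0 S, E.filter (fun u => adj v0 u), v0, ?_, ?_, by simp, ?_, ?_, ?_, ?_⟩
      · exact (Finset.card_insert_le _ _).trans (by omega)
      · rw [Finset.disjoint_insert_left]
        exact ⟨(h7 v0 hv0).1, h2⟩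
      · intro u hu
        by_cases h : u = v0
        · exact Or.inl h
        · right
          apply (h7 v0 hv0).2
          simp only [Finset.mem_insert] at hu ⊢
          tauto
      · calc _ = 2 ^ c * (2 * (E.filter (fun u => adj v0 u)).card) := by ring
          _ ≤ 2 ^ c * E.card := Nat.mul_le_mul_left _ hh
          _ ≤ _ := h5
      · intro v hv hvE hU
        simp only [Finset.mem_insert, not_or] at hv
        by_cases hvE' : v ∈ E
        · refine ⟨v0, by simp, ?_⟩
          rcases hT.2.2 v v0 hv.2.1 with h | h
          · exact h
          · exact absurd (by simp [hvE', h]) hvE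
        · obtain ⟨u, hu, huv⟩ := h6 v (by simp [hv.1, hv.2.2]) hvE' hU
          refine ⟨u, ?_, huv⟩
          simp only [Finset.mem_insert] at hu ⊢
          tauto
      · intro v hv
        simp only [Finset.mem_filter] at hv
        refine ⟨(h7 v hv.1).1, ?_⟩
        intro u hu
        simp only [Finset.mem_insert] at hu
        rcases hu with rfl | rfl | hu
        · exact (h7 v hv.1).2 _ (by simp)
        · exact hv.2
        · exact (h7 v hv.1).2 _ (by simp [hu])

lemma greedy {J : Type*} (s : Finset J) (F0 : Finset V) (m M : ℕ)
    (p : J → Finset V → Finset V → Prop)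
    (h : ∀ j ∈ s, ∀ F : Finset V, F0 ⊆ F → F.card ≤ M →
      ∃ S : Finset V, S.card ≤ m ∧ Disjoint S F ∧ p j F S)
    (hM : F0.card + s.card * m ≤ M) :
    ∃ S F : J → Finset V, (∀ j ∈ s, (S j).card ≤ m ∧ Disjoint (S j) F0 ∧ p j (F j) (S j) ∧
      F j ⊆ F0 ∪ s.biUnion S) ∧ ∀ i ∈ s, ∀ j ∈ s, i ≠ j → Disjoint (S i) (S j) := by
  induction s using Finset.induction_on with
  | empty => exact ⟨fun _ => ∅, fun _ => ∅, by simp, by simp⟩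
  | insert j0 s hj0 ih =>
    rw [Finset.card_insert_of_notMem hj0] at hM
    obtain ⟨S, F, h1, h2⟩ := ih (fun j hj => h j (Finset.mem_insert_of_mem hj))
      (hM.trans' (by nlinarith))
    have hc : (F0 ∪ s.biUnion S).card ≤ M := by
      refine (Finset.card_union_le _ _).trans ?_
      have := Finset.card_biUnion_le_card_mul s S m (fun j hj => (h1 j hj).1)
      nlinarith
    obtain ⟨S0, h3, h4, h5⟩ := h j0 (by simp) (F0 ∪ s.biUnion S) Finset.subset_union_left hc
    rw [Finset.disjoint_union_right, Finset.disjoint_biUnion_right] at h4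
    have hne : ∀ j ∈ s, j ≠ j0 := fun j hj e => hj0 (e ▸ hj)
    have hbi : s.biUnion (Function.update S j0 S0) = s.biUnion S :=
      Finset.biUnion_congr rfl (fun j hj => by simp [hne j hj])
    refine ⟨Function.update S j0 S0, Function.update F j0 (F0 ∪ s.biUnion S), ?_, ?_⟩
    · intro j hj
      rw [Finset.biUnion_insert, hbi]
      rcases Finset.mem_insert.1 hj with rfl | hj
      · simp only [Function.update_self]
        refine ⟨h3, h4.1, h5, ?_⟩
        grind
      · have := h1 j hj
        simp only [Function.update_of_ne (hne j hj)]
        refine ⟨this.1, this.2.1, this.2.2.1, this.2.2.2.trans ?_⟩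
        grind
    · intro i hi j hj hij
      rcases Finset.mem_insert.1 hi with rfl | hi2 <;> rcases Finset.mem_insert.1 hj with rfl | hj2
      · exact absurd rfl hij
      · simpa [hne j hj2] using h4.2 j hj2
      · simpa [hne i hi2] using (h4.2 i hi2).symm
      · simpa [hne i hi2, hne j hj2] using h2 i hi2 j hj2 hij

/-- goodness -/
inductive Gd {V : Type*} (adj : V → V → Prop) (k : ℕ) (base G : Set V) : V → Prop
  | base (v : V) : v ∈ G → v ∈ base → Gd adj k base G v
  | step (v : V) (s : Finset V) : v ∈ G → k ≤ s.card → (∀ u ∈ s, adj v u) →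
      (∀ u ∈ s, Gd adj k base G u) → Gd adj k base G v

lemma Gd.mono {V : Type*} {adj : V → V → Prop} {k : ℕ} {base G G' : Set V} (h : G ⊆ G') {v : V}
    (hv : Gd adj k base G v) : Gd adj k base G' v := by
  induction hv with
  | base v h1 h2 => exact Gd.base v (h h1) h2
  | step v s h1 h2 h3 _ ih => exact Gd.step v s (h h1) h2 h3 ih

lemma Gd.mem {V : Type*} {adj : V → V → Prop} {k : ℕ} {base G : Set V} {v : V}
    (hv : Gd adj k base G v) : v ∈ G := by
  cases hv <;> assumption

lemma Gd.reach {V : Type*} {adj : V → V → Prop} {k : ℕ} {base G : Set V} {v : V} (A S : Set V)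
    (hA : A ⊆ G) (hAS : ∀ a ∈ A, a ∉ S) (hb : ∀ v ∈ base, ∃ a ∈ A, adj v a)
    (hS : S.Finite) (hSk : S.ncard < k) (hv : Gd adj k base G v) (hvS : v ∉ S) :
    ∃ a ∈ A, ReachIn adj (G \ S) v a := by
  induction hv with
  | base v h1 h2 =>
    obtain ⟨a, ha, hva⟩ := hb v h2
    exact ⟨a, ha, Relation.ReflTransGen.single ⟨⟨h1, hvS⟩, ⟨hA ha, hAS a ha⟩, hva⟩⟩
  | step v s h1 h2 h3 h4 ih =>
    have : ∃ u ∈ s, u ∉ S := by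
      by_contra hcon
      push Not at hcon
      have := Set.ncard_le_ncard (s := (s : Set V)) (t := S) hcon hS
      rw [Set.ncard_coe_finset] at this
      omega
    obtain ⟨u, hu, huS⟩ := this
    obtain ⟨a, ha, hr⟩ := ih u hu huS
    exact ⟨a, ha, Relation.ReflTransGen.head ⟨⟨h1, hvS⟩, ⟨(h4 u hu).mem, huS⟩, h3 u hu⟩ hr⟩

lemma reach_flip {V : Type*} {adj : V → V → Prop} {U : Set V} {x y : V}
    (h : ReachIn (flip adj) U x y) : ReachIn adj U y x := by
  unfold ReachIn at *
  induction h with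
  | refl => exact Relation.ReflTransGen.refl
  | tail _ hab ih => exact Relation.ReflTransGen.head ⟨hab.2.1, hab.1, hab.2.2⟩ ih

lemma reach_mono {V : Type*} {adj : V → V → Prop} {U U' : Set V} (h : U ⊆ U') {x y : V}
    (hr : ReachIn adj U x y) : ReachIn adj U' x y := by
  unfold ReachIn at *
  induction hr with
  | refl => exact Relation.ReflTransGen.refl
  | tail _ hab ih => exact Relation.ReflTransGen.tail ih ⟨h hab.1, h hab.2.1, hab.2.2⟩

lemma core {adj : V → V → Prop} {k : ℕ} {Ob Ib U : Set V} (A B H : Fin k → Set V)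
    (hcard : k < U.ncard)
    (hHU : ∀ j, H j ⊆ U) (hH : ∀ i j, i ≠ j → Disjoint (H i) (H j))
    (hA : ∀ j, A j ⊆ H j) (hB : ∀ j, B j ⊆ H j)
    (hAB : ∀ j, ∀ a ∈ A j, ∀ b ∈ B j, ReachIn adj (H j) a b)
    (hOb : ∀ v ∈ Ob, ∀ j, ∃ a ∈ A j, adj v a) (hIb : ∀ v ∈ Ib, ∀ j, ∃ b ∈ B j, adj b v)
    (hO : ∀ v ∈ U, Gd adj k Ob U v) (hI : ∀ v ∈ U, Gd (flip adj) k Ib U v) :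
    StrKConnOn adj k U := by
  refine ⟨hcard, ?_⟩
  intro S hSU hSk x hx y hy
  have hSf : S.Finite := Set.toFinite S
  have : ∃ j, Disjoint (H j) S := by
    by_contra hcon
    push Not at hcon
    simp only [Set.not_disjoint_iff] at hcon
    choose f hf1 hf2 using hcon
    have hinj : Function.Injective f := by
      intro i j hij
      by_contra hne
      exact Set.disjoint_left.1 (hH i j hne) (hf1 i) (hij ▸ hf1 j)
    have h1 : (Set.range f).ncard = k := by
      rw [← Set.image_univ, Set.ncard_image_of_injective _ hinj, Set.ncard_univ]; simp
    have h2 := Set.ncard_le_ncard (s := Set.range f) (t := S)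
      (by rintro _ ⟨j, rfl⟩; exact hf2 j) hSf
    omega
  obtain ⟨j, hj⟩ := this
  have hd : ∀ a ∈ H j, a ∉ S := fun a ha => Set.disjoint_left.1 hj ha
  obtain ⟨a, ha, hxa⟩ := (hO x hx.1).reach (A j) S ((hA j).trans (hHU j))
    (fun a h => hd a (hA j h)) (fun v hv => hOb v hv j) hSf hSk hx.2
  obtain ⟨b, hb, hyb⟩ := (hI y hy.1).reach (B j) S ((hB j).trans (hHU j))
    (fun a h => hd a (hB j h)) (fun v hv => hIb v hv j) hSf hSk hy.2
  have hab := reach_mono (U' := U \ S) (fun v hv => ⟨hHU j hv, hd v hv⟩) (hAB j a ha b hb)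
  exact (hxa.trans hab).trans (reach_flip hyb)

lemma smallest (f : V → ℕ) (s : Finset V) (N : ℕ) (h : N ≤ s.card) :
    ∃ X ⊆ s, X.card = N ∧ ∀ x ∈ X, ∀ v ∈ s \ X, f x ≤ f v := by
  induction N with
  | zero => exact ⟨∅, by simp, by simp, by simp⟩
  | succ N ih =>
    obtain ⟨X, h1, h2, h3⟩ := ih (by omega)
    have hne : (s \ X).Nonempty := by
      rw [← Finset.card_pos, Finset.card_sdiff_of_subset h1]; omega
    obtain ⟨m, hm, hmin⟩ := Finset.exists_min_image (s \ X) f hne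
    rw [Finset.mem_sdiff] at hm
    refine ⟨insert m X, Finset.insert_subset hm.1 h1, ?_, ?_⟩
    · rw [Finset.card_insert_of_notMem hm.2, h2]
    · intro x hx v hv
      have hv' : v ∈ s \ X := by grind
      rcases Finset.mem_insert.1 hx with rfl | hx
      · exact hmin v hv'
      · exact h3 x hx v hv'

lemma smallest' (f : V → ℕ) (s : Finset V) (N K : ℕ) (h : N ≤ s.card) (hN : 0 < N)
    (hK : ∀ v, K ≤ f v) :
    ∃ X ⊆ s, ∃ d, X.card = N ∧ K ≤ d ∧ (∀ x ∈ X, f x ≤ d) ∧ ∀ v ∈ s \ X, d ≤ f v := by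
  obtain ⟨X, h1, h2, h3⟩ := smallest f s N h
  have hne : X.Nonempty := by rw [← Finset.card_pos]; omega
  obtain ⟨m, hm, hmax⟩ := Finset.exists_max_image X f hne
  exact ⟨X, h1, f m, h2, hK m, hmax, fun v hv => h3 m hm v hv⟩

lemma abstract_cmp {R : Type*} {N : ℕ} (f : R → Fin N → ℕ) (γ H : ℕ) (S : Finset R)
    (hcmp : ∀ e ∈ S, ∀ e' ∈ S, ∀ g h, f e g + γ ≤ f e' g → f e' h + γ ≤ f e h → False)
    (hS : ∀ e ∈ S, ∃ g, H ≤ f e g) (g0 : Fin N) (hγ : 0 < γ) :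
    ∃ g, ∀ e ∈ S, H ≤ f e g + γ * N := by
  rcases S.eq_empty_or_nonempty with rfl | hne
  · exact ⟨g0, by simp⟩
  obtain ⟨m, hm, hmin⟩ := Finset.exists_min_image S (fun e => ∑ g, f e g) hne
  obtain ⟨g, hg⟩ := hS m hm
  refine ⟨g, fun e he => ?_⟩
  by_contra hcon
  push Not at hcon
  have hN : 1 ≤ N := by have := g0.2; omega
  have h1 : γ ≤ γ * N := by nlinarith
  have h2 : ∀ h, f e h < f m h + γ := by
    intro h
    by_contra hc
    exact hcmp e he m hm g h (by omega) (by omega)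
  have h3 := hmin e he
  have h4 : ∑ h ∈ Finset.univ.erase g, f e h ≤ ∑ h ∈ Finset.univ.erase g, (f m h + γ) :=
    Finset.sum_le_sum (fun h _ => (h2 h).le)
  rw [Finset.sum_add_distrib, Finset.sum_const, Finset.card_erase_of_mem (Finset.mem_univ _)] at h4
  simp only [Finset.card_univ, Fintype.card_fin, smul_eq_mul] at h4
  rw [← Finset.add_sum_erase _ _ (Finset.mem_univ g), ← Finset.add_sum_erase _ _ (Finset.mem_univ g)] at h3
  have h5 : (N - 1) * γ + γ = γ * N := by
    obtain ⟨n, rfl⟩ : ∃ n, N = n + 1 := ⟨N - 1, by omega⟩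
    simp; ring
  omega

lemma comb7 (k t N : ℕ) (hN : N = 100 * k * t) (hk : 1 ≤ k) (ht : 1 ≤ t)
    (h : Fin N → Finset (Fin N)) (h4 : ∀ g, (h g).card ≤ 4) (hg : ∀ g, g ∈ h g) (p q : Fin N)
    (z : Fin t) :
    ∃ (ι : Fin t × Fin k → Fin N) (cl : Fin N → Fin t), Function.Injective ι ∧
      (∀ i j g, ι (i, j) ∈ h g → cl g = i) ∧ cl p = z ∧ cl q = z := by
  let D : Fin N → Finset (Fin N) := fun P => Finset.univ.filter (fun Q => P ∈ h Q)
  have hsum : ∑ P, (D P).card ≤ 4 * N := by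
    have := Finset.sum_card_bipartiteAbove_eq_sum_card_bipartiteBelow
      (s := (Finset.univ : Finset (Fin N))) (t := (Finset.univ : Finset (Fin N)))
      (fun P Q => P ∈ h Q)
    simp only [Finset.bipartiteAbove, Finset.bipartiteBelow, Finset.filter_mem_eq_inter,
      Finset.univ_inter] at this
    calc ∑ P, (D P).card = ∑ Q, (h Q).card := this
      _ ≤ ∑ Q : Fin N, 4 := Finset.sum_le_sum (fun Q _ => h4 Q)
      _ = _ := by simp; ring
  let L := Finset.univ.filter (fun P => (D P).card ≤ 8)
  have hL : 9 * (Finset.univ \ L).card ≤ 4 * N := by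
    refine le_trans ?_ hsum
    calc 9 * (Finset.univ \ L).card = ∑ P ∈ Finset.univ \ L, 9 := by simp; ring
      _ ≤ ∑ P ∈ Finset.univ \ L, (D P).card := Finset.sum_le_sum (fun P hP => by
          simp [L] at hP; omega)
      _ ≤ _ := Finset.sum_le_sum_of_subset (Finset.subset_univ _)
  have hL2 : (Finset.univ \ L).card + L.card = N := by
    rw [Finset.card_sdiff_add_card_eq_card (Finset.subset_univ _)]; simp
  let L' := L \ (h p ∪ h q)
  have hL' : L.card ≤ L'.card + 8 := by
    have h1 := Finset.card_le_card_sdiff_add_card (s := L) (t := h p ∪ h q)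
    have h2 := Finset.card_union_le (h p) (h q)
    have := h4 p
    have := h4 q
    simp only [L']
    omega
  have hexI : ∃ I : Finset (Fin N), Maximal (fun I => I ⊆ L' ∧ ∀ Q, (h Q ∩ I).card ≤ 1) I := by
    obtain ⟨I, -, hI⟩ := Finite.exists_le_maximal (α := Finset (Fin N))
      (p := fun I => I ⊆ L' ∧ ∀ Q, (h Q ∩ I).card ≤ 1) (a := ∅) (by simp)
    exact ⟨I, hI⟩
  obtain ⟨I, hI⟩ := hexI
  have hcov : L' ⊆ I.biUnion (fun P => (D P).biUnion h) := by
    intro P' hP'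
    simp only [Finset.mem_biUnion, D, Finset.mem_filter, Finset.mem_univ, true_and]
    by_cases hPI : P' ∈ I
    · exact ⟨P', hPI, P', hg P', hg P'⟩
    by_contra hcon
    push Not at hcon
    have : insert P' I ⊆ I := by
      refine hI.2 ⟨Finset.insert_subset hP' hI.1.1, ?_⟩ (Finset.subset_insert _ _)
      intro Q
      by_cases hPQ : P' ∈ h Q
      · rw [Finset.card_le_one]
        intro a ha b hb
        have : ∀ c ∈ h Q ∩ insert P' I, c = P' := by
          intro c hc
          simp only [Finset.mem_inter, Finset.mem_insert] at hc
          rcases hc.2 with h1 | h1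
          · exact h1
          · exact absurd hPQ (hcon c h1 Q hc.1)
        rw [this a ha, this b hb]
      · rw [Finset.inter_insert_of_notMem hPQ]
        exact hI.1.2 Q
    exact hPI (this (Finset.mem_insert_self _ _))
  have hc1 : L'.card ≤ I.card * 32 := by
    refine (Finset.card_le_card hcov).trans (Finset.card_biUnion_le_card_mul _ _ _ ?_)
    intro P hP
    have hPL : (D P).card ≤ 8 := by
      have := hI.1.1 hP
      simp only [L', L, Finset.mem_sdiff, Finset.mem_filter] at this
      exact this.1.2
    have := Finset.card_biUnion_le_card_mul (D P) h 4 (fun Q _ => h4 Q)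
    omega
  have hkt : 1 ≤ k * t := Nat.mul_pos hk ht
  have hc2 : k * t ≤ I.card := by
    have : N = 100 * (k * t) := by rw [hN]; ring
    omega
  have hcardle : Fintype.card (Fin t × Fin k) ≤ Fintype.card I := by
    simp; rw [mul_comm]; exact hc2
  obtain ⟨e⟩ := Function.Embedding.nonempty_of_card_le hcardle
  have hone : ∀ Q a b, a ∈ I → b ∈ I → a ∈ h Q → b ∈ h Q → a = b := by
    intro Q a b ha hb h1 h2
    exact Finset.card_le_one.1 (hI.1.2 Q) a (by simp [ha, h1]) b (by simp [hb, h2])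
  have hz : ∀ x, (x = p ∨ x = q) → ∀ a ∈ I, a ∉ h x := by
    intro x hx a ha hax
    have := hI.1.1 ha
    simp only [L', Finset.mem_sdiff, Finset.mem_union, not_or] at this
    rcases hx with rfl | rfl
    · exact this.2.1 hax
    · exact this.2.2 hax
  refine ⟨fun x => (e x : Fin N), fun g => if hx : ∃ x, (e x : Fin N) ∈ h g then hx.choose.1 else z,
    ?_, ?_, ?_, ?_⟩
  · intro x y hxy
    exact e.injective (Subtype.ext hxy)
  · intro i j g hij
    have hx : ∃ x, (e x : Fin N) ∈ h g := ⟨(i, j), hij⟩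
    simp only [dif_pos hx]
    have := hone g _ _ (e hx.choose).2 (e (i, j)).2 hx.choose_spec hij
    rw [e.injective (Subtype.ext this)]
  · beta_reduce
    rw [dif_neg]
    rintro ⟨x, hx⟩
    exact hz p (Or.inl rfl) _ (e x).2 hx
  · beta_reduce
    rw [dif_neg]
    rintro ⟨x, hx⟩
    exact hz q (Or.inr rfl) _ (e x).2 hx

lemma menger_aux {N : ℕ} (r : V → V → Prop) (A B : Finset V) (hA : A.card = N)
    (hsep : ∀ S : Finset V, S.card < N → ∃ a ∈ A, ∃ b ∈ B, a ∉ S ∧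
      Relation.ReflTransGen (fun u v => r u v ∧ u ∉ S ∧ v ∉ S) a b) :
    ∃ f : V → V, (∀ u v, u ∉ B → v ∉ B → f u = f v → u = v) ∧
      (∀ v, v ∉ B → f v ∉ A ∧ (f v = v ∨ r v (f v))) := by
  let T : {v : V // v ∉ B} → Finset V := fun v =>
    Finset.univ.filter (fun w => w ∉ A ∧ (w = v ∨ r v w))
  have key := (Finset.all_card_le_biUnion_card_iff_exists_injective T).1 (by
    intro s
    by_contra hlt
    push Not at hlt
    let S : Finset V := s.map (Function.Embedding.subtype _)
    have hSc : S.card = s.card := Finset.card_map _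
    have hSB : ∀ v ∈ S, v ∉ B := by
      intro v hv
      simp only [S, Finset.mem_map, Function.Embedding.coe_subtype] at hv
      obtain ⟨w, -, rfl⟩ := hv
      exact w.2
    have hmem : ∀ v w, v ∈ S → w ∉ A → (w = v ∨ r v w) → w ∈ s.biUnion T := by
      intro v w hv hw hvw
      simp only [S, Finset.mem_map, Function.Embedding.coe_subtype] at hv
      obtain ⟨x, hx, rfl⟩ := hv
      simp only [Finset.mem_biUnion]
      exact ⟨x, hx, by simp [T, hw, hvw]⟩
    let NS := s.biUnion T
    have h1 : S \ A ⊆ NS := by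
      intro v hv
      rw [Finset.mem_sdiff] at hv
      exact hmem v v hv.1 hv.2 (Or.inl rfl)
    have hc : ((NS \ S) ∪ (A \ S)).card < N := by
      have e1 := Finset.card_union_le (NS \ S) (A \ S)
      have e2 : (NS \ S).card + (S \ A).card ≤ NS.card := by
        rw [← Finset.card_union_of_disjoint]
        · exact Finset.card_le_card (Finset.union_subset Finset.sdiff_subset h1)
        · rw [Finset.disjoint_left]; intro v; simp only [Finset.mem_sdiff]; tauto
      have e3 := Finset.card_sdiff_add_card_inter A S
      have e4 := Finset.card_sdiff_add_card_inter S A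
      rw [Finset.inter_comm] at e4
      have : NS.card < s.card := hlt
      omega
    obtain ⟨a, ha, b, hb, haS, hr⟩ := hsep _ hc
    have : ∀ v, Relation.ReflTransGen (fun u v => r u v ∧ u ∉ (NS \ S) ∪ (A \ S) ∧
        v ∉ (NS \ S) ∪ (A \ S)) a v → v ∈ S := by
      intro v hv
      induction hv with
      | refl =>
        simp only [Finset.mem_union, Finset.mem_sdiff, not_or] at haS
        tauto
      | tail _ huv ih =>
        rename_i u w _
        have h3 := huv.2.2
        simp only [Finset.mem_union, Finset.mem_sdiff, not_or] at h3
        by_cases hwA : w ∈ A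
        · tauto
        · have := hmem u w ih hwA (Or.inr huv.1)
          by_contra hwS
          exact h3.1 ⟨this, hwS⟩
    exact hSB b (this b hr) hb)
  obtain ⟨f, hf1, hf2⟩ := key
  refine ⟨fun v => if h : v ∈ B then v else f ⟨v, h⟩, ?_, ?_⟩
  · intro u v hu hv huv
    simp only [dif_neg hu, dif_neg hv] at huv
    simpa using hf1 huv
  · intro v hv
    simp only [dif_neg hv]
    have := hf2 ⟨v, hv⟩
    simpa [T] using this

def PT {V : Type*} (r : V → V → Prop) (x y : V) (l : List V) : Prop :=
  l.head? = some x ∧ l.getLast? = some y ∧ l.IsChain r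

def Sys {V : Type*} {N : ℕ} (r : V → V → Prop) (a b : Fin N → V) (P : Fin N → List V) : Prop :=
  (∀ g, ∃ h, PT r (a g) (b h) (P g)) ∧ ∀ g h, g ≠ h → ∀ v ∈ P g, v ∉ P h

lemma menger {N : ℕ} (r : V → V → Prop) (a b : Fin N → V) (ha : Function.Injective a)
    (hsep : ∀ S : Finset V, S.card < N → ∃ i j, a i ∉ S ∧
      Relation.ReflTransGen (fun u v => r u v ∧ u ∉ S ∧ v ∉ S) (a i) (b j)) :
    ∃ P, Sys r a b P := by
  obtain ⟨f, hf1, hf2⟩ := menger_aux (N := N) r (Finset.univ.image a) (Finset.univ.image b)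
    (by rw [Finset.card_image_of_injective _ ha]; simp) (by
      intro S hS
      obtain ⟨i, j, h1, h2⟩ := hsep S hS
      exact ⟨a i, by simp, b j, by simp, h1, h2⟩)
  set B := Finset.univ.image b with hB
  set A := Finset.univ.image a with hA
  have haA : ∀ g, a g ∈ A := fun g => by simp [hA]
  have key : ∀ i j g g', (∀ i' < i, f^[i'] (a g) ∉ B) → (∀ j' < j, f^[j'] (a g') ∉ B) →
      f^[i] (a g) = f^[j] (a g') → i = j ∧ g = g' := by
    intro i
    induction i with
    | zero =>
      intro j g g' h1 h2 h3
      cases j with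
      | zero => exact ⟨rfl, ha h3⟩
      | succ j =>
        rw [Function.iterate_succ_apply'] at h3
        have := (hf2 _ (h2 j (by omega))).1
        rw [← h3] at this
        exact absurd (haA g) this
    | succ i ih =>
      intro j g g' h1 h2 h3
      cases j with
      | zero =>
        rw [Function.iterate_succ_apply'] at h3
        have := (hf2 _ (h1 i (by omega))).1
        rw [h3] at this
        exact absurd (haA g') this
      | succ j =>
        rw [Function.iterate_succ_apply', Function.iterate_succ_apply'] at h3
        have := ih j g g' (fun i' h => h1 i' (by omega)) (fun i' h => h2 i' (by omega))
          (hf1 _ _ (h1 i (by omega)) (h2 j (by omega)) h3)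
        exact ⟨by omega, this.2⟩
  have hex : ∀ g, ∃ i, f^[i] (a g) ∈ B := by
    intro g
    by_contra hcon
    push Not at hcon
    exact not_injective_infinite_finite (fun i : ℕ => f^[i] (a g))
      (fun i j hij => (key i j g g (fun _ _ => hcon _) (fun _ _ => hcon _) hij).1)
  let n : Fin N → ℕ := fun g => Nat.find (hex g)
  have hn1 : ∀ g, f^[n g] (a g) ∈ B := fun g => Nat.find_spec (hex g)
  have hn2 : ∀ g i, i < n g → f^[i] (a g) ∉ B := fun g i hi => Nat.find_min (hex g) hi
  refine ⟨fun g => (List.range (n g + 1)).map (fun i => f^[i] (a g)), ?_, ?_⟩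
  · intro g
    have := hn1 g
    simp only [hB, Finset.mem_image, Finset.mem_univ, true_and] at this
    obtain ⟨h, hh⟩ := this
    refine ⟨h, ?_, ?_, ?_⟩
    · simp
    · simp [List.range_succ, hh]
    · rw [List.isChain_map, List.isChain_range_succ]
      intro m hm
      rw [Function.iterate_succ_apply']
      rcases (hf2 _ (hn2 g m hm)).2 with h | h
      · have := (key (m+1) m g g (fun i hi => hn2 g i (by omega)) (fun i hi => hn2 g i (by omega))
          (by rw [Function.iterate_succ_apply', h])).1
        omega
      · exact h
  · intro g h hgh v hv hv'
    simp only [List.mem_map, List.mem_range] at hv hv'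
    obtain ⟨i, hi, rfl⟩ := hv
    obtain ⟨j, hj, hij⟩ := hv'
    exact hgh (key i j g h (fun i' h' => hn2 g i' (by omega)) (fun i' h' => hn2 h i' (by omega))
      hij.symm).2

lemma pt_splice {V : Type*} {r : V → V → Prop} {x y x' y' e : V} {p q : List V} (hp : PT r x y p)
    (hq : PT r x' y' q) (i j : ℕ) (hi : i < p.length) (hj : j < q.length)
    (h1 : r p[i] e) (h2 : r e q[j]) : PT r x y' (p.take (i + 1) ++ e :: q.drop j) := by
  refine ⟨?_, ?_, ?_⟩
  · rw [List.head?_append, List.head?_take]; simp [hp.1]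
  · rw [List.getLast?_append, List.getLast?_cons, List.getLast?_drop, hq.2.1, if_neg (by omega)]; simp
  · rw [List.isChain_append]
    refine ⟨hp.2.2.take _, ?_, ?_⟩
    · rw [List.isChain_cons]
      refine ⟨?_, hq.2.2.drop _⟩
      intro z hz
      rw [List.head?_drop, List.getElem?_eq_getElem hj] at hz
      cases hz; exact h2
    · intro z hz w hw
      rw [List.getLast?_take] at hz
      simp [List.getElem?_eq_getElem hi] at hz hw
      subst hz; subst hw; exact h1

lemma pt_front {V : Type*} {r : V → V → Prop} {x y a f : V} {p : List V} (hp : PT r x y p)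
    (j : ℕ) (hj : j < p.length)
    (h1 : r a f) (h2 : r f p[j]) : PT r a y (a :: f :: p.drop j) := by
  refine ⟨by simp, ?_, ?_⟩
  · rw [List.getLast?_cons, List.getLast?_cons, List.getLast?_drop, hp.2.1, if_neg (by omega)]; simp
  · rw [List.isChain_cons_cons, List.isChain_cons]
    refine ⟨h1, ?_, hp.2.2.drop _⟩
    intro z hz
    rw [List.head?_drop, List.getElem?_eq_getElem hj] at hz
    cases hz; exact h2

lemma pt_back {V : Type*} {r : V → V → Prop} {x y b f : V} {p : List V} (hp : PT r x y p)
    (i : ℕ) (hi : i < p.length)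
    (h1 : r p[i] f) (h2 : r f b) : PT r x b (p.take (i + 1) ++ [f, b]) := by
  refine ⟨?_, ?_, ?_⟩
  · rw [List.head?_append, List.head?_take]; simp [hp.1]
  · simp
  · rw [List.isChain_append]
    refine ⟨hp.2.2.take _, by simp [h2], ?_⟩
    intro z hz w hw
    rw [List.getLast?_take] at hz
    simp [List.getElem?_eq_getElem hi] at hz hw
    subst hz; subst hw; exact h1

lemma pt_dup {V : Type*} {r : V → V → Prop} {x y : V} {p : List V} (hp : PT r x y p)
    (i j : ℕ) (hij : i < j) (hj : j < p.length) (h : p[i] = p[j]) :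
    PT r x y (p.take i ++ p.drop j) := by
  have hd : (p.drop j).head? = some p[j] := by rw [List.head?_drop, List.getElem?_eq_getElem hj]
  refine ⟨?_, ?_, ?_⟩
  · rw [List.head?_append, List.head?_take, hd]
    by_cases hi : i = 0
    · subst hi
      simp only [if_true, Option.none_or]
      rw [← h, ← hp.1, List.head?_eq_getElem?, List.getElem?_eq_getElem]
    · simp [hi, hp.1]
  · rw [List.getLast?_append, List.getLast?_drop, hp.2.1, if_neg (by omega)]; simp
  · rw [List.isChain_append]
    refine ⟨hp.2.2.take _, hp.2.2.drop _, ?_⟩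
    intro z hz w hw
    rw [hd] at hw
    cases hw
    rw [← h]
    rw [List.getLast?_take] at hz
    by_cases hi : i = 0
    · simp [hi] at hz
    · have h1 : i - 1 < p.length := by omega
      simp [hi, List.getElem?_eq_getElem h1] at hz
      subst hz
      have := List.isChain_iff_getElem.1 hp.2.2 (i - 1) (by omega)
      simpa [Nat.sub_add_cancel (Nat.one_le_iff_ne_zero.2 hi)] using this

def MSys {V : Type*} {N : ℕ} (r : V → V → Prop) (a b : Fin N → V) (P : Fin N → List V) : Prop :=
  Sys r a b P ∧ ∀ P', Sys r a b P' → ∑ g, (P g).length ≤ ∑ g, (P' g).length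

lemma exists_msys {V : Type*} {N : ℕ} {r : V → V → Prop} {a b : Fin N → V} (h : ∃ P, Sys r a b P) :
    ∃ P, MSys r a b P := by
  have h' : ∃ n, ∃ P, Sys r a b P ∧ ∑ g, (P g).length = n := by
    obtain ⟨P, hP⟩ := h
    exact ⟨_, P, hP, rfl⟩
  obtain ⟨P, hP, hn⟩ := Nat.find_spec h'
  refine ⟨P, hP, fun P' hP' => ?_⟩
  rw [hn]
  exact Nat.find_min' h' ⟨P', hP', rfl⟩

lemma repl1 {V : Type*} {N : ℕ} {r : V → V → Prop} {a b : Fin N → V} {P : Fin N → List V}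
    (hP : MSys r a b P) (g h : Fin N) (l : List V) (hl : PT r (a g) (b h) l)
    (hd : ∀ v ∈ l, ∀ g', v ∈ P g' → g' = g) : (P g).length ≤ l.length := by
  have := hP.2 (Function.update P g l) ⟨?_, ?_⟩
  · rw [← Finset.add_sum_erase _ _ (Finset.mem_univ g),
      ← Finset.add_sum_erase _ _ (Finset.mem_univ g)] at this
    have e : ∑ x ∈ Finset.univ.erase g, (Function.update P g l x).length =
        ∑ x ∈ Finset.univ.erase g, (P x).length := Finset.sum_congr rfl
      (fun g' hg' => by rw [Function.update_of_ne (Finset.ne_of_mem_erase hg')])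
    simp only [Function.update_self] at this
    omega
  · intro g'
    by_cases hg : g' = g
    · subst hg; exact ⟨h, by simpa using hl⟩
    · simpa [hg] using hP.1.1 g'
  · intro g1 g2 h12 v hv hv'
    by_cases h1 : g1 = g
    · subst h1
      have h2 : g2 ≠ g1 := fun e => h12 e.symm
      simp only [Function.update_self, Function.update_of_ne h2] at hv hv'
      exact h2 (hd v hv g2 hv')
    · by_cases h2 : g2 = g
      · subst h2
        simp only [Function.update_self, Function.update_of_ne h1] at hv hv'
        exact h1 (hd v hv' g1 hv)
      · simp only [Function.update_of_ne h1, Function.update_of_ne h2] at hv hv'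
        exact hP.1.2 g1 g2 h12 v hv hv'

lemma repl2 {V : Type*} {N : ℕ} {r : V → V → Prop} {a b : Fin N → V} {P : Fin N → List V}
    (hP : MSys r a b P) (g h : Fin N) (hgh : g ≠ h) (g' h' : Fin N) (l l' : List V)
    (hl : PT r (a g) (b g') l) (hl' : PT r (a h) (b h') l')
    (hd : ∀ v ∈ l, ∀ i, v ∈ P i → i = g ∨ i = h) (hd' : ∀ v ∈ l', ∀ i, v ∈ P i → i = g ∨ i = h)
    (hll : ∀ v ∈ l, v ∉ l') :
    (P g).length + (P h).length ≤ l.length + l'.length := by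
  have hev : ∀ i, (Function.update (Function.update P g l) h l') i =
      if i = h then l' else if i = g then l else P i := by
    intro i
    simp only [Function.update_apply]
  have := hP.2 (Function.update (Function.update P g l) h l') ⟨?_, ?_⟩
  · have hg : g ∈ Finset.univ.erase h := by simp [hgh]
    rw [← Finset.add_sum_erase _ _ (Finset.mem_univ h),
      ← Finset.add_sum_erase _ _ (Finset.mem_univ h),
      ← Finset.add_sum_erase _ _ hg, ← Finset.add_sum_erase _ _ hg] at this
    have e : ∑ x ∈ (Finset.univ.erase h).erase g,
        (Function.update (Function.update P g l) h l' x).length =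
        ∑ x ∈ (Finset.univ.erase h).erase g, (P x).length := Finset.sum_congr rfl
      (fun i hi => by
        simp only [Finset.mem_erase] at hi
        rw [hev]; simp [hi.1, hi.2.1])
    rw [e, hev, hev] at this
    simp only [hgh, if_true, if_false] at this
    omega
  · intro i
    rw [hev]
    split_ifs with h1 h2
    · subst h1; exact ⟨_, hl'⟩
    · subst h2; exact ⟨_, hl⟩
    · exact hP.1.1 i
  · intro g1 g2 h12 v hv hv'
    rw [hev] at hv hv'
    have h0 := hP.1.2 g1 g2 h12 v
    have := hd v
    have := hd' v
    have := hll v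
    grind

lemma MSys.nodup {V : Type*} {N : ℕ} {r : V → V → Prop} {a b : Fin N → V} {P : Fin N → List V}
    (hP : MSys r a b P) (g : Fin N) : (P g).Nodup := by
  rw [List.nodup_iff_injective_getElem]
  by_contra hcon
  rw [Function.Injective] at hcon
  push Not at hcon
  obtain ⟨h, hh⟩ := hP.1.1 g
  have key : ∀ i j (hij : i < j) (hj : j < (P g).length), (P g)[i] = (P g)[j] → False := by
    intro i j hij hj e
    have := repl1 hP g h _ (pt_dup hh i j hij hj e) (by
      intro v hv g' hg'
      by_contra hne
      refine hP.1.2 g' g hne v hg' ?_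
      rw [List.mem_append] at hv
      rcases hv with hv | hv
      · exact List.mem_of_mem_take hv
      · exact List.mem_of_mem_drop hv)
    simp only [List.length_append, List.length_take, List.length_drop] at this
    omega
  obtain ⟨i, j, e, hne⟩ := hcon
  rcases lt_or_gt_of_ne (fun e => hne (Fin.ext e) : (i : ℕ) ≠ j) with h1 | h1
  · exact key i j h1 j.2 e
  · exact key j i h1 i.2 e.symm

lemma cnt_fst {V : Type*} (q : V → Prop) (l : List V) (h : 0 < (l.filter (fun v => q v)).length) :
    ∃ (i : ℕ) (hi : i < l.length), q l[i] ∧ (l.filter (fun v => q v)).length + i ≤ l.length := by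
  induction l with
  | nil => simp at h
  | cons x l ih =>
    by_cases hx : q x
    · refine ⟨0, by simp, by simpa using hx, ?_⟩
      exact List.length_filter_le _ _
    · rw [List.filter_cons_of_neg (by simpa using hx)] at h ⊢
      obtain ⟨i, hi, h1, h2⟩ := ih h
      exact ⟨i + 1, by simpa using hi, by simpa using h1, by simp; omega⟩

lemma cnt_lst {V : Type*} (q : V → Prop) (l : List V) (h : 0 < (l.filter (fun v => q v)).length) :
    ∃ (i : ℕ) (hi : i < l.length), q l[i] ∧ (l.filter (fun v => q v)).length ≤ i + 1 := by
  induction l with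
  | nil => simp at h
  | cons x l ih =>
    by_cases hl : 0 < (l.filter (fun v => q v)).length
    · obtain ⟨i, hi, h1, h2⟩ := ih hl
      refine ⟨i + 1, by simpa using hi, by simpa using h1, ?_⟩
      rw [List.filter_cons]
      split_ifs
      · simp; omega
      · omega
    · refine ⟨0, by simp, ?_, ?_⟩
      · by_contra hx
        rw [List.filter_cons_of_neg (by simpa using hx)] at h
        exact hl h
      · rw [List.filter_cons]
        split_ifs
        · simp only [List.length_cons]; omega
        · omega

lemma swapF {V : Type*} {N : ℕ} {r : V → V → Prop} {a b : Fin N → V} {P : Fin N → List V}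
    (hP : MSys r a b P) (g h : Fin N) (hgh : g ≠ h) (e e' : V) (hee : e ≠ e')
    (he : ∀ i, e ∉ P i) (he' : ∀ i, e' ∉ P i)
    (h1 : (P g).length + 4 ≤ ((P g).filter (fun u => r u e)).length
        + ((P g).filter (fun u => r e' u)).length)
    (h2 : (P h).length + 4 ≤ ((P h).filter (fun u => r u e')).length
        + ((P h).filter (fun u => r e u)).length) : False := by
  have l1 := List.length_filter_le (fun u => decide (r u e)) (P g)
  have l2 := List.length_filter_le (fun u => decide (r e' u)) (P g)
  have l3 := List.length_filter_le (fun u => decide (r u e')) (P h)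
  have l4 := List.length_filter_le (fun u => decide (r e u)) (P h)
  obtain ⟨i, hi, hi1, hi2⟩ := cnt_fst (fun u => r u e) (P g) (by omega)
  obtain ⟨j', hj', hj1', hj2'⟩ := cnt_lst (fun u => r e' u) (P g) (by omega)
  obtain ⟨i', hi', hi1', hi2'⟩ := cnt_fst (fun u => r u e') (P h) (by omega)
  obtain ⟨j, hj, hj1, hj2⟩ := cnt_lst (fun u => r e u) (P h) (by omega)
  obtain ⟨σg, hg⟩ := hP.1.1 g
  obtain ⟨σh, hh⟩ := hP.1.1 h
  have hu : ∀ {v x y}, v ∈ P x → v ∈ P y → y = x := by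
    intro v x y hx hy
    by_contra hne
    exact hP.1.2 y x hne v hy hx
  have d1 := List.disjoint_take_drop (hP.nodup g) (m := i + 1) (n := j') (by omega)
  have d2 := List.disjoint_take_drop (hP.nodup h) (m := i' + 1) (n := j) (by omega)
  have := repl2 hP g h hgh σh σg _ _ (pt_splice hg hh i j hi hj hi1 hj1)
    (pt_splice hh hg i' j' hi' hj' hi1' hj1') (by
      intro v hv x hx
      rw [List.mem_append, List.mem_cons] at hv
      rcases hv with hv | rfl | hv
      · left; exact hu (List.mem_of_mem_take hv) hx
      · exact absurd hx (he x)
      · right; exact hu (List.mem_of_mem_drop hv) hx) (by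
      intro v hv x hx
      rw [List.mem_append, List.mem_cons] at hv
      rcases hv with hv | rfl | hv
      · right; exact hu (List.mem_of_mem_take hv) hx
      · exact absurd hx (he' x)
      · left; exact hu (List.mem_of_mem_drop hv) hx) (by
      intro v hv hv'
      rw [List.mem_append, List.mem_cons] at hv hv'
      rcases hv with hv | rfl | hv <;> rcases hv' with hv' | rfl | hv'
      · exact hgh (hu (List.mem_of_mem_take hv') (List.mem_of_mem_take hv))
      · exact he' g (List.mem_of_mem_take hv)
      · exact d1 hv hv'
      · exact he h (List.mem_of_mem_take hv')
      · exact hee rfl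
      · exact he g (List.mem_of_mem_drop hv')
      · exact d2 hv' hv
      · exact he' h (List.mem_of_mem_drop hv)
      · exact hgh (hu (List.mem_of_mem_drop hv) (List.mem_of_mem_drop hv')))
  simp only [List.length_append, List.length_take, List.length_drop, List.length_cons] at this
  omega

structure Dat {V : Type*} [Fintype V] (adj : V → V → Prop) (k N K d D : ℕ) (A B : Fin N → Finset V)
    (a b : Fin N → V) (Em Ep W0 : Finset V) : Prop where
  tour : IsTournament adj
  hk : 1 ≤ k
  outd : ∀ v, K ≤ (oN adj v).card
  ind : ∀ v, K ≤ (oN (flip adj) v).card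
  outd' : ∀ v, v ∉ W0 → d ≤ (oN adj v).card
  ind' : ∀ v, v ∉ W0 → D ≤ (oN (flip adj) v).card
  Kd : K ≤ d
  dD : d ≤ D
  Em8 : 8 * Em.card ≤ d
  Ep8 : 8 * Ep.card ≤ D
  aA : ∀ g, a g ∈ A g
  bB : ∀ g, b g ∈ B g
  sinkA : ∀ g, ∀ u ∈ A g, u = a g ∨ adj u (a g)
  srcB : ∀ g, ∀ u ∈ B g, u = b g ∨ adj (b g) u
  disjA : ∀ g h, g ≠ h → Disjoint (A g) (A h)
  disjB : ∀ g h, g ≠ h → Disjoint (B g) (B h)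
  disjAB : ∀ g h, Disjoint (A g) (B h)
  AW : ∀ g, A g ⊆ W0
  BW : ∀ g, B g ⊆ W0
  WAB : ∀ v ∈ W0, (∃ g, v ∈ A g) ∨ ∃ g, v ∈ B g
  domA : ∀ v, v ∉ W0 → v ∉ Em → ∀ g, ∃ u ∈ A g, adj v u
  domB : ∀ v, v ∉ W0 → v ∉ Ep → ∀ g, ∃ u ∈ B g, adj u v

lemma card_bi_exc {N c d : ℕ} (E : Fin N → Finset V) (hN : 0 < N) (hc : 8 * N ≤ 2 ^ c)
    (h : ∀ g, 2 ^ c * (E g).card ≤ d) : 8 * (Finset.univ.biUnion E).card ≤ d := by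
  have h1 : (Finset.univ.biUnion E).card ≤ ∑ g, (E g).card := Finset.card_biUnion_le
  have h2 : ∑ g, 2 ^ c * (E g).card ≤ ∑ g : Fin N, d := Finset.sum_le_sum (fun g _ => h g)
  rw [← Finset.mul_sum] at h2
  simp at h2
  have h3 : N * (8 * (Finset.univ.biUnion E).card) ≤ N * d := by
    calc N * (8 * (Finset.univ.biUnion E).card) = 8 * N * (Finset.univ.biUnion E).card := by ring
      _ ≤ 2 ^ c * ∑ g, (E g).card := Nat.mul_le_mul hc h1
      _ ≤ _ := h2
  exact Nat.le_of_mul_le_mul_left h3 hN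

lemma step1 {adj : V → V → Prop} (hT : IsTournament adj) (k N K d D c : ℕ) (hk : 1 ≤ k)
    (hN : 0 < N) (hc : 8 * N ≤ 2 ^ c) (X Y : Finset V) (hX : X.card = N) (hY : Y.card = N)
    (hXY : Disjoint X Y)
    (outd : ∀ v, K ≤ (oN adj v).card) (ind : ∀ v, K ≤ (oN (flip adj) v).card)
    (outd' : ∀ v, v ∉ X ∪ Y → d ≤ (oN adj v).card)
    (ind' : ∀ v, v ∉ X ∪ Y → D ≤ (oN (flip adj) v).card)
    (hXd : ∀ v ∈ X, (oN adj v).card ≤ d) (hYD : ∀ v ∈ Y, (oN (flip adj) v).card ≤ D)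
    (Kd : K ≤ d) (dD : d ≤ D) :
    ∃ A B a b Em Ep W0, Dat adj k N K d D A B a b Em Ep W0 ∧ W0.card ≤ 2 * N * (c + 1) := by
  let x := (X.equivFinOfCardEq hX).symm
  let y := (Y.equivFinOfCardEq hY).symm
  obtain ⟨S, F, h1, h2⟩ := greedy (V := V) (Finset.univ : Finset (Fin N ⊕ Fin N)) (X ∪ Y) c
    ((X ∪ Y).card + (Finset.univ : Finset (Fin N ⊕ Fin N)).card * c)
    (fun j F S => match j with
      | .inl g => ∃ (E : Finset V) (a : V), a ∈ insert (x g : V) S ∧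
        (∀ u ∈ insert (x g : V) S, u = a ∨ adj u a) ∧ 2 ^ c * E.card ≤ d ∧
        (∀ v, v ∉ insert (x g : V) S → v ∉ E → v ∉ F → ∃ u ∈ insert (x g : V) S, adj v u)
      | .inr g => ∃ (E : Finset V) (a : V), a ∈ insert (y g : V) S ∧
        (∀ u ∈ insert (y g : V) S, u = a ∨ adj a u) ∧ 2 ^ c * E.card ≤ D ∧
        (∀ v, v ∉ insert (y g : V) S → v ∉ E → v ∉ F → ∃ u ∈ insert (y g : V) S, adj u v))
    (by
      intro j _ F _ _
      cases j with
      | inl g =>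
        obtain ⟨S, E, a, h1, h2, h3, h4, h5, h6⟩ := dom hT (x g : V) F c
        exact ⟨S, h1, h2, E, a, h3, h4, h5.trans (hXd _ (x g).2), h6⟩
      | inr g =>
        obtain ⟨S, E, a, h1, h2, h3, h4, h5, h6⟩ := dom (flipT hT) (y g : V) F c
        exact ⟨S, h1, h2, E, a, h3, h4, h5.trans (hYD _ (y g).2), h6⟩) le_rfl
  have hA := fun g : Fin N => (h1 (.inl g) (Finset.mem_univ _)).2.2.1
  have hB := fun g : Fin N => (h1 (.inr g) (Finset.mem_univ _)).2.2.1
  simp only at hA hB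
  choose E a ha1 ha2 ha3 ha4 using hA
  choose E' b hb1 hb2 hb3 hb4 using hB
  have hS0 : ∀ j v, v ∈ S j → v ∉ X ∧ v ∉ Y := by
    intro j v hv
    have := Finset.disjoint_left.1 (h1 j (Finset.mem_univ _)).2.1 hv
    simpa using this
  have hSS : ∀ i j v, v ∈ S i → v ∈ S j → i = j := by
    intro i j v hi hj
    by_contra hne
    exact Finset.disjoint_left.1 (h2 i (Finset.mem_univ _) j (Finset.mem_univ _) hne) hi hj
  have hFW : ∀ j, F j ⊆ (Finset.univ.biUnion fun g : Fin N => insert (x g : V) (S (.inl g))) ∪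
      (Finset.univ.biUnion fun g : Fin N => insert (y g : V) (S (.inr g))) := by
    intro j v hv
    have := (h1 j (Finset.mem_univ _)).2.2.2 hv
    simp only [Finset.mem_union, Finset.mem_biUnion, Finset.mem_univ, true_and,
      Finset.mem_insert] at this ⊢
    rcases this with (h | h) | ⟨i, h⟩
    · left; exact ⟨X.equivFinOfCardEq hX ⟨v, h⟩, by simp [x]⟩
    · right; exact ⟨Y.equivFinOfCardEq hY ⟨v, h⟩, by simp [y]⟩
    · cases i with
      | inl g => left; exact ⟨g, Or.inr h⟩
      | inr g => right; exact ⟨g, Or.inr h⟩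
  have hXYW : ∀ v, v ∉ (Finset.univ.biUnion fun g : Fin N => insert (x g : V) (S (.inl g))) ∪
      (Finset.univ.biUnion fun g : Fin N => insert (y g : V) (S (.inr g))) → v ∉ X ∪ Y := by
    intro v hv hXY
    apply hv
    simp only [Finset.mem_union, Finset.mem_biUnion, Finset.mem_univ, true_and,
      Finset.mem_insert] at hXY ⊢
    rcases hXY with h | h
    · left; exact ⟨X.equivFinOfCardEq hX ⟨v, h⟩, by simp [x]⟩
    · right; exact ⟨Y.equivFinOfCardEq hY ⟨v, h⟩, by simp [y]⟩
  refine ⟨fun g => insert (x g : V) (S (.inl g)), fun g => insert (y g : V) (S (.inr g)), a, b,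
    Finset.univ.biUnion E, Finset.univ.biUnion E',
    (Finset.univ.biUnion fun g : Fin N => insert (x g : V) (S (.inl g))) ∪
      (Finset.univ.biUnion fun g : Fin N => insert (y g : V) (S (.inr g))), ?_, ?_⟩
  · refine ⟨hT, hk, outd, ind, fun v hv => outd' v (hXYW v hv), fun v hv => ind' v (hXYW v hv),
      Kd, dD, card_bi_exc E hN hc ha3, card_bi_exc E' hN hc hb3, ha1, hb1, ha2, hb2, ?_, ?_, ?_,
      ?_, ?_, ?_, ?_, ?_⟩
    · intro g h hgh
      rw [Finset.disjoint_left]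
      intro v hv hv'
      rw [Finset.mem_insert] at hv hv'
      rcases hv with rfl | hv <;> rcases hv' with hv' | hv'
      · exact hgh (x.injective (Subtype.ext hv'))
      · exact (hS0 _ _ hv').1 (x g).2
      · exact (hS0 _ _ hv).1 (hv' ▸ (x h).2)
      · have := hSS _ _ _ hv hv'
        simp at this; exact hgh this
    · intro g h hgh
      rw [Finset.disjoint_left]
      intro v hv hv'
      rw [Finset.mem_insert] at hv hv'
      rcases hv with rfl | hv <;> rcases hv' with hv' | hv'
      · exact hgh (y.injective (Subtype.ext hv'))
      · exact (hS0 _ _ hv').2 (y g).2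
      · exact (hS0 _ _ hv).2 (hv' ▸ (y h).2)
      · have := hSS _ _ _ hv hv'
        simp at this; exact hgh this
    · intro g h
      rw [Finset.disjoint_left]
      intro v hv hv'
      rw [Finset.mem_insert] at hv hv'
      rcases hv with rfl | hv <;> rcases hv' with hv' | hv'
      · exact Finset.disjoint_left.1 hXY (x g).2 (hv' ▸ (y h).2)
      · exact (hS0 _ _ hv').1 (x g).2
      · exact (hS0 _ _ hv).2 (hv' ▸ (y h).2)
      · have := hSS _ _ _ hv hv'
        simp at this
    · intro g
      refine Finset.Subset.trans ?_ Finset.subset_union_left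
      exact Finset.subset_biUnion_of_mem (fun g : Fin N => insert (x g : V) (S (.inl g)))
        (Finset.mem_univ g)
    · intro g
      refine Finset.Subset.trans ?_ Finset.subset_union_right
      exact Finset.subset_biUnion_of_mem (fun g : Fin N => insert (y g : V) (S (.inr g)))
        (Finset.mem_univ g)
    · intro v hv
      simpa only [Finset.mem_union, Finset.mem_biUnion, Finset.mem_univ, true_and] using hv
    · intro v hv hvE g
      refine ha4 g v ?_ ?_ (fun h => hv (hFW _ h))
      · intro h; apply hv
        simp only [Finset.mem_union, Finset.mem_biUnion, Finset.mem_univ, true_and]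
        exact Or.inl ⟨g, h⟩
      · intro h; apply hvE
        simp only [Finset.mem_biUnion, Finset.mem_univ, true_and]
        exact ⟨g, h⟩
    · intro v hv hvE g
      refine hb4 g v ?_ ?_ (fun h => hv (hFW _ h))
      · intro h; apply hv
        simp only [Finset.mem_union, Finset.mem_biUnion, Finset.mem_univ, true_and]
        exact Or.inr ⟨g, h⟩
      · intro h; apply hvE
        simp only [Finset.mem_biUnion, Finset.mem_univ, true_and]
        exact ⟨g, h⟩
  · have e1 := Finset.card_biUnion_le_card_mul (Finset.univ : Finset (Fin N))
      (fun g : Fin N => insert (x g : V) (S (.inl g))) (c + 1) (fun g _ =>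
        (Finset.card_insert_le _ _).trans (Nat.succ_le_succ (h1 (.inl g) (Finset.mem_univ _)).1))
    have e2 := Finset.card_biUnion_le_card_mul (Finset.univ : Finset (Fin N))
      (fun g : Fin N => insert (y g : V) (S (.inr g))) (c + 1) (fun g _ =>
        (Finset.card_insert_le _ _).trans (Nat.succ_le_succ (h1 (.inr g) (Finset.mem_univ _)).1))
    refine (Finset.card_union_le _ _).trans ?_
    simp only [Finset.card_univ, Fintype.card_fin] at e1 e2
    nlinarith

/-- closed set -/
def Cl {V : Type*} (adj : V → V → Prop) (k : ℕ) (W0 Em Ep : Finset V) (G : Finset V) : Prop :=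
  ∀ v ∈ G, Gd adj k {v | v ∉ W0 ∧ v ∉ Em} (G : Set V) v ∧
    Gd (flip adj) k {v | v ∉ W0 ∧ v ∉ Ep} (G : Set V) v

lemma Cl.bi {J : Type*} {adj : V → V → Prop} {k : ℕ} {W0 Em Ep : Finset V} (s : Finset J)
    (C : J → Finset V) (h : ∀ j ∈ s, Cl adj k W0 Em Ep (C j)) :
    Cl adj k W0 Em Ep (s.biUnion C) := by
  intro v hv
  rw [Finset.mem_biUnion] at hv
  obtain ⟨j, hj, hv⟩ := hv
  have hs : (C j : Set V) ⊆ (s.biUnion C : Finset V) := by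
    exact_mod_cast Finset.subset_biUnion_of_mem C hj
  exact ⟨(h j hj v hv).1.mono hs, (h j hj v hv).2.mono hs⟩

lemma Cl.un {adj : V → V → Prop} {k : ℕ} {W0 Em Ep : Finset V} {G G' : Finset V}
    (h : Cl adj k W0 Em Ep G) (h' : Cl adj k W0 Em Ep G') : Cl adj k W0 Em Ep (G ∪ G') := by
  intro v hv
  rw [Finset.mem_union] at hv
  rcases hv with hv | hv
  · exact ⟨(h v hv).1.mono (by simp), (h v hv).2.mono (by simp)⟩
  · exact ⟨(h' v hv).1.mono (by simp), (h' v hv).2.mono (by simp)⟩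

lemma pick (s F : Finset V) (k : ℕ) (h : F.card + k ≤ s.card) :
    ∃ T ⊆ s, T.card = k ∧ ∀ v ∈ T, v ∉ F := by
  have h1 := Finset.le_card_sdiff F s
  obtain ⟨T, hT, hc⟩ := Finset.exists_subset_card_eq (s := s \ F) (n := k) (by omega)
  refine ⟨T, hT.trans Finset.sdiff_subset, hc, fun v hv => ?_⟩
  have := hT hv
  rw [Finset.mem_sdiff] at this
  exact this.2

section clos
variable {adj : V → V → Prop} {k N K d D : ℕ} {A B : Fin N → Finset V} {a b : Fin N → V}
  {Em Ep W0 : Finset V}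

/-- add a vertex with given outs and ins into closed set -/
lemma Cl.add {G : Finset V} (h : Cl adj k W0 Em Ep G) (v : V) (s s' : Finset V)
    (h1 : (v ∉ W0 ∧ v ∉ Em) ∨ (s ⊆ G ∧ k ≤ s.card ∧ ∀ u ∈ s, adj v u))
    (h2 : (v ∉ W0 ∧ v ∉ Ep) ∨ (s' ⊆ G ∧ k ≤ s'.card ∧ ∀ u ∈ s', adj u v)) :
    Cl adj k W0 Em Ep (insert v G) := by
  have hs : (G : Set V) ⊆ (insert v G : Finset V) := by simp
  have hv : v ∈ ((insert v G : Finset V) : Set V) := by simp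
  intro w hw
  rw [Finset.mem_insert] at hw
  rcases hw with rfl | hw
  · constructor
    · rcases h1 with h1 | h1
      · exact Gd.base _ hv h1
      · exact Gd.step _ s hv h1.2.1 h1.2.2 (fun u hu => (h u (h1.1 hu)).1.mono hs)
    · rcases h2 with h2 | h2
      · exact Gd.base _ hv h2
      · exact Gd.step _ s' hv h2.2.1 h2.2.2 (fun u hu => (h u (h2.1 hu)).2.mono hs)
  · exact ⟨(h w hw).1.mono hs, (h w hw).2.mono hs⟩

lemma Cl.empty : Cl adj k W0 Em Ep (∅ : Finset V) := by
  intro v hv; simp at hv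

lemma Cl.free (G : Finset V) (h : ∀ v ∈ G, v ∉ W0 ∧ v ∉ Em ∧ v ∉ Ep) : Cl adj k W0 Em Ep G := by
  intro v hv
  exact ⟨Gd.base _ hv ⟨(h v hv).1, (h v hv).2.1⟩, Gd.base _ hv ⟨(h v hv).1, (h v hv).2.2⟩⟩

lemma Dat.ins (h : Dat adj k N K d D A B a b Em Ep W0) (F : Finset V)
    (hF : 2 * (F.card + k) ≤ K) (z : V) (hz : z ∉ W0) :
    ∃ s : Finset V, s.card = k ∧ (∀ w ∈ s, adj w z ∧ w ∉ F ∧ w ∉ Em ∧ w ∉ Ep) := by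
  have h1 := h.ind' z hz
  have := h.Kd
  have := h.dD
  have := h.Em8
  have := h.Ep8
  have e1 := Finset.card_union_le F (Em ∪ Ep)
  have e2 := Finset.card_union_le Em Ep
  obtain ⟨T, hT, hc, hn⟩ := pick (oN (flip adj) z) (F ∪ (Em ∪ Ep)) k (by omega)
  refine ⟨T, hc, fun w hw => ?_⟩
  have h3 := hn w hw
  simp only [Finset.mem_union, not_or] at h3
  exact ⟨(mem_oN (flip adj) w z).1 (hT hw), h3.1, h3.2.1, h3.2.2⟩

lemma Dat.cl2 (h : Dat adj k N K d D A B a b Em Ep W0) (F : Finset V) (hWF : W0 ⊆ F)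
    (hF : 2 * (F.card + k) ≤ K) (z : V) (hz : z ∉ F) (hzE : z ∉ Em) :
    ∃ C : Finset V, z ∈ C ∧ C.card ≤ k + 1 ∧ (∀ x ∈ C, x ∉ F) ∧ Cl adj k W0 Em Ep C := by
  obtain ⟨s, hs, hs2⟩ := h.ins F hF z (fun h => hz (hWF h))
  refine ⟨insert z s, by simp, (Finset.card_insert_le _ _).trans (by omega), ?_, ?_⟩
  · intro x hx
    rcases Finset.mem_insert.1 hx with rfl | hx
    · exact hz
    · exact (hs2 x hx).2.1
  · refine Cl.add (Cl.free s (fun v hv => ⟨fun h => (hs2 v hv).2.1 (hWF h), (hs2 v hv).2.2⟩))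
      z ∅ s (Or.inl ⟨fun h => hz (hWF h), hzE⟩) (Or.inr ⟨subset_rfl, hs.ge, fun u hu => (hs2 u hu).1⟩)

lemma Dat.cl1 (h : Dat adj k N K d D A B a b Em Ep W0) (F : Finset V) (hWF : W0 ⊆ F)
    (hF : 2 * (F.card + k) ≤ K) (u : V) (hu : u ∉ F) :
    ∃ C : Finset V, u ∈ C ∧ C.card ≤ k * (k + 1) + k + 1 ∧ (∀ x ∈ C, x ∉ F) ∧
      Cl adj k W0 Em Ep C := by
  have huW : u ∉ W0 := fun h => hu (hWF h)
  obtain ⟨s, hs, hs2⟩ := h.ins F hF u huW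
  have h1 := h.outd' u huW
  have := h.Kd
  have := h.Em8
  have e1 := Finset.card_union_le F Em
  obtain ⟨T, hT, hTc, hTn⟩ := pick (oN adj u) (F ∪ Em) k (by omega)
  simp only [Finset.mem_union, not_or] at hTn
  choose! C hC1 hC2 hC3 hC4 using fun z (hz : z ∈ T) => h.cl2 F hWF hF z (hTn z hz).1 (hTn z hz).2
  have e2 := Finset.card_biUnion_le_card_mul T C (k + 1) hC2
  refine ⟨insert u (T.biUnion C ∪ s), by simp, ?_, ?_, ?_⟩
  · refine (Finset.card_insert_le _ _).trans ?_
    have := Finset.card_union_le (T.biUnion C) s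
    rw [hTc] at e2
    omega
  · intro x hx
    simp only [Finset.mem_insert, Finset.mem_union, Finset.mem_biUnion] at hx
    rcases hx with rfl | ⟨z, hz, hx⟩ | hx
    · exact hu
    · exact hC3 z hz x hx
    · exact (hs2 x hx).2.1
  · refine Cl.add (Cl.un (Cl.bi T C hC4)
      (Cl.free s (fun v hv => ⟨fun h => (hs2 v hv).2.1 (hWF h), (hs2 v hv).2.2⟩))) u T s
      (Or.inr ⟨?_, hTc.ge, ?_⟩) (Or.inr ⟨Finset.subset_union_right, hs.ge, fun u hu => (hs2 u hu).1⟩)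
    · intro z hz
      exact Finset.mem_union_left _ (Finset.mem_biUnion.2 ⟨z, hz, hC1 z hz⟩)
    · intro z hz
      exact (mem_oN _ _ _).1 (hT hz)

lemma Dat.cl0 (h : Dat adj k N K d D A B a b Em Ep W0) (F : Finset V) (hWF : W0 ⊆ F)
    (hF : 2 * (F.card + k) ≤ K) (v : V) :
    ∃ G : Finset V, G.card ≤ 8 * k ^ 3 ∧ (∀ x ∈ G, x ∉ F) ∧ 
      ∃ s s' : Finset V, s ⊆ G ∧ s' ⊆ G ∧ s.card = k ∧ s'.card = k ∧ (∀ u ∈ s, adj v u) ∧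
        (∀ u ∈ s', adj u v) ∧ Cl adj k W0 Em Ep (insert v G) := by
  obtain ⟨s, hs, hsc, hsn⟩ := pick (oN adj v) F k (by have := h.outd v; omega)
  obtain ⟨s', hs', hsc', hsn'⟩ := pick (oN (flip adj) v) F k (by have := h.ind v; omega)
  have hall : ∀ u ∈ s ∪ s', u ∉ F := by
    intro u hu
    rcases Finset.mem_union.1 hu with hu | hu
    · exact hsn u hu
    · exact hsn' u hu
  choose! C hC1 hC2 hC3 hC4 using fun u (hu : u ∈ s ∪ s') => h.cl1 F hWF hF u (hall u hu)
  have hsub : s ∪ s' ⊆ (s ∪ s').biUnion C := fun u hu => Finset.mem_biUnion.2 ⟨u, hu, hC1 u hu⟩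
  refine ⟨(s ∪ s').biUnion C, ?_, ?_, s, s', Finset.subset_union_left.trans hsub,
    Finset.subset_union_right.trans hsub, hsc, hsc', ?_, ?_, ?_⟩
  · have e1 := Finset.card_biUnion_le_card_mul _ C _ hC2
    have e2 := Finset.card_union_le s s'
    have hk := h.hk
    calc _ ≤ (s ∪ s').card * (k * (k + 1) + k + 1) := e1
      _ ≤ (2 * k) * (k * (k + 1) + k + 1) := Nat.mul_le_mul_right _ (by omega)
      _ ≤ 8 * k ^ 3 := by nlinarith [Nat.mul_le_mul hk hk, Nat.mul_le_mul (Nat.mul_le_mul hk hk) (le_refl k)]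
  · intro x hx
    rw [Finset.mem_biUnion] at hx
    obtain ⟨u, hu, hx⟩ := hx
    exact hC3 u hu x hx
  · exact fun u hu => (mem_oN _ _ _).1 (hs hu)
  · exact fun u hu => (mem_oN (flip adj) _ _).1 (hs' hu)
  · exact Cl.add (Cl.bi _ C hC4) v s s'
      (Or.inr ⟨Finset.subset_union_left.trans hsub, hsc.ge, fun u hu => (mem_oN _ _ _).1 (hs hu)⟩)
      (Or.inr ⟨Finset.subset_union_right.trans hsub, hsc'.ge,
        fun u hu => (mem_oN (flip adj) _ _).1 (hs' hu)⟩)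

end clos

structure Dat2 {V : Type*} [Fintype V] (adj : V → V → Prop) (k N : ℕ) (A B : Fin N → Finset V)
    (a b : Fin N → V) (Em Ep W0 : Finset V) (RA RB Fp Fm : Fin N → Finset V) (W : Finset V) :
    Prop where
  clA : ∀ g, Cl adj k W0 Em Ep (RA g)
  clB : ∀ g, Cl adj k W0 Em Ep (RB g)
  disjRA : ∀ g h, g ≠ h → Disjoint (RA g) (RA h)
  disjRB : ∀ g h, g ≠ h → Disjoint (RB g) (RB h)
  disjRAB : ∀ g h, Disjoint (RA g) (RB h)
  RAW : ∀ g, RA g ⊆ W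
  RBW : ∀ g, RB g ⊆ W
  WR : ∀ v ∈ W, (∃ g, v ∈ RA g) ∨ ∃ g, v ∈ RB g
  ARA : ∀ g, A g ⊆ RA g
  BRB : ∀ g, B g ⊆ RB g
  FpRA : ∀ g, Fp g ⊆ RA g
  FmRB : ∀ g, Fm g ⊆ RB g
  Fpc : ∀ g, (Fp g).card = k
  Fmc : ∀ g, (Fm g).card = k
  Fpa : ∀ g, ∀ f ∈ Fp g, adj (a g) f
  Fmb : ∀ g, ∀ f ∈ Fm g, adj f (b g)
  W0W : W0 ⊆ W

lemma step2 {adj : V → V → Prop} {k N K d D : ℕ} {A B : Fin N → Finset V} {a b : Fin N → V}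
    {Em Ep W0 : Finset V} (h : Dat adj k N K d D A B a b Em Ep W0)
    (hK : 2 * (W0.card + W0.card * (8 * k ^ 3) + k) ≤ K) :
    ∃ RA RB Fp Fm W, Dat2 adj k N A B a b Em Ep W0 RA RB Fp Fm W ∧
      W.card ≤ W0.card + W0.card * (8 * k ^ 3) := by
  obtain ⟨G, F, h1, h2⟩ := greedy (V := V) W0 W0 (8 * k ^ 3) (W0.card + W0.card * (8 * k ^ 3))
    (fun v _ G => ∃ s s' : Finset V, s ⊆ G ∧ s' ⊆ G ∧ s.card = k ∧ s'.card = k ∧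
      (∀ u ∈ s, adj v u) ∧ (∀ u ∈ s', adj u v) ∧ Cl adj k W0 Em Ep (insert v G))
    (by
      intro v _ F hWF hF
      obtain ⟨G, hG1, hG2, hG3⟩ := h.cl0 F hWF (by omega) v
      exact ⟨G, hG1, Finset.disjoint_left.2 hG2, hG3⟩) le_rfl
  choose! s s' hs1 hs2 hs3 hs4 hs5 hs6 hs7 using fun v (hv : v ∈ W0) => (h1 v hv).2.2.1
  have haW : ∀ g, a g ∈ W0 := fun g => h.AW g (h.aA g)
  have hbW : ∀ g, b g ∈ W0 := fun g => h.BW g (h.bB g)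
  have hR : ∀ X Y : Finset V, X ⊆ W0 → Y ⊆ W0 → Disjoint X Y →
      Disjoint (X.biUnion fun u => insert u (G u)) (Y.biUnion fun u => insert u (G u)) := by
    intro X Y hX hY hXY
    rw [Finset.disjoint_left]
    intro v hv hv'
    rw [Finset.mem_biUnion] at hv hv'
    obtain ⟨x, hx, hv⟩ := hv
    obtain ⟨y, hy, hv'⟩ := hv'
    have hxy : x ≠ y := fun e => Finset.disjoint_left.1 hXY hx (e ▸ hy)
    rw [Finset.mem_insert] at hv hv'
    rcases hv with rfl | hv <;> rcases hv' with hv' | hv'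
    · exact hxy hv'
    · exact Finset.disjoint_left.1 (h1 y (hY hy)).2.1 hv' (hX hx)
    · exact Finset.disjoint_left.1 (h1 x (hX hx)).2.1 hv (hv' ▸ hY hy)
    · exact Finset.disjoint_left.1 (h2 x (hX hx) y (hY hy) hxy) hv hv'
  have hsub : ∀ X : Finset V, X ⊆ X.biUnion fun u => insert u (G u) := fun X u hu =>
    Finset.mem_biUnion.2 ⟨u, hu, Finset.mem_insert_self _ _⟩
  have hG : ∀ (X : Finset V) u, u ∈ X → G u ⊆ X.biUnion fun u => insert u (G u) := fun X u hu v hv =>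
    Finset.mem_biUnion.2 ⟨u, hu, Finset.mem_insert_of_mem hv⟩
  have hmono : ∀ X : Finset V, X ⊆ W0 → (X.biUnion fun u => insert u (G u)) ⊆
      W0.biUnion fun u => insert u (G u) := fun X hX => Finset.biUnion_subset_biUnion_of_subset_left _ hX
  refine ⟨fun g => (A g).biUnion fun u => insert u (G u), fun g => (B g).biUnion fun u => insert u (G u),
    fun g => s (a g), fun g => s' (b g), W0.biUnion fun u => insert u (G u), ?_, ?_⟩
  · refine ⟨?_, ?_, ?_, ?_, ?_, ?_, ?_, ?_, ?_, ?_, ?_, ?_, ?_, ?_, ?_, ?_, ?_⟩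
    · exact fun g => Cl.bi _ _ (fun u hu => hs7 u (h.AW g hu))
    · exact fun g => Cl.bi _ _ (fun u hu => hs7 u (h.BW g hu))
    · exact fun g g' hg => hR _ _ (h.AW g) (h.AW g') (h.disjA g g' hg)
    · exact fun g g' hg => hR _ _ (h.BW g) (h.BW g') (h.disjB g g' hg)
    · exact fun g g' => hR _ _ (h.AW g) (h.BW g') (h.disjAB g g')
    · exact fun g => hmono _ (h.AW g)
    · exact fun g => hmono _ (h.BW g)
    · intro v hv
      rw [Finset.mem_biUnion] at hv
      obtain ⟨u, hu, hv⟩ := hv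
      rcases h.WAB u hu with ⟨g, hg⟩ | ⟨g, hg⟩
      · exact Or.inl ⟨g, Finset.mem_biUnion.2 ⟨u, hg, hv⟩⟩
      · exact Or.inr ⟨g, Finset.mem_biUnion.2 ⟨u, hg, hv⟩⟩
    · exact fun g => hsub _
    · exact fun g => hsub _
    · exact fun g => (hs1 _ (haW g)).trans (hG _ _ (h.aA g))
    · exact fun g => (hs2 _ (hbW g)).trans (hG _ _ (h.bB g))
    · exact fun g => hs3 _ (haW g)
    · exact fun g => hs4 _ (hbW g)
    · exact fun g => hs5 _ (haW g)
    · exact fun g => hs6 _ (hbW g)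
    · exact hsub _
  · have := Finset.card_biUnion_le_card_mul W0 (fun u => insert u (G u)) (8 * k ^ 3 + 1)
      (fun u hu => (Finset.card_insert_le _ _).trans (Nat.succ_le_succ (h1 u hu).1))
    nlinarith

def rr {V : Type*} {N : ℕ} (adj : V → V → Prop) (a b : Fin N → V) (Fp Fm : Fin N → Finset V)
    (W : Finset V) (u v : V) : Prop :=
  adj u v ∧ ((∃ g, u = a g ∧ v ∈ Fp g) ∨ (∃ g, u ∈ Fp g ∧ v ∉ W) ∨ (u ∉ W ∧ v ∉ W) ∨
    (∃ h, u ∉ W ∧ v ∈ Fm h) ∨ (∃ h, u ∈ Fm h ∧ v = b h))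

lemma pigeon {N : ℕ} (R : Fin N → Finset V) (hR : ∀ g h, g ≠ h → Disjoint (R g) (R h))
    (S : Finset V) (hS : S.card < N) : ∃ g, ∀ v ∈ R g, v ∉ S := by
  by_contra hcon
  push Not at hcon
  choose f hf1 hf2 using hcon
  have hinj : Function.Injective f := by
    intro i j hij
    by_contra hne
    exact Finset.disjoint_left.1 (hR i j hne) (hf1 i) (hij ▸ hf1 j)
  have h1 := Finset.card_le_card (s := Finset.univ.image f) (t := S) (by
    intro v hv
    simp only [Finset.mem_image, Finset.mem_univ, true_and] at hv
    obtain ⟨g, rfl⟩ := hv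
    exact hf2 g)
  rw [Finset.card_image_of_injective _ hinj] at h1
  simp at h1
  omega

structure Dat3 {V : Type*} [Fintype V] (adj : V → V → Prop) (k N : ℕ)
    (a b : Fin N → V) (Fp Fm : Fin N → Finset V) (W : Finset V)
    (P : Fin N → Finset V) (σ : Fin N → Fin N) (x y : Fin N → V) : Prop where
  aP : ∀ g, a g ∈ P g
  bP : ∀ g, b (σ g) ∈ P g
  reach : ∀ g, ReachIn adj (P g : Set V) (a g) (b (σ g))
  disj : ∀ g h, g ≠ h → Disjoint (P g) (P h)
  bij : Function.Bijective σ
  PW : ∀ g, ∀ v ∈ P g, v ∈ W → v = a g ∨ v ∈ Fp g ∨ v ∈ Fm (σ g) ∨ v = b (σ g)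
  xo : ∀ g, ∀ v ∈ P g, v ∉ W → v ≠ x g → ∀ f ∈ Fp g, adj v f
  yi : ∀ g, ∀ v ∈ P g, v ∉ W → v ≠ y g → ∀ f ∈ Fm (σ g), adj f v
  cmp : ∀ e e', e ∉ W → e' ∉ W → (∀ g, e ∉ P g) → (∀ g, e' ∉ P g) → ∀ g h,
    ((P g).filter (fun u => u ∉ W ∧ adj u e)).card + ((P g).filter (fun u => u ∉ W ∧ adj e u)).card
      + (2 * k + 6) ≤ ((P g).filter (fun u => u ∉ W ∧ adj u e)).card
      + ((P g).filter (fun u => u ∉ W ∧ adj e' u)).card →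
    ((P h).filter (fun u => u ∉ W ∧ adj u e')).card + ((P h).filter (fun u => u ∉ W ∧ adj e' u)).card
      + (2 * k + 6) ≤ ((P h).filter (fun u => u ∉ W ∧ adj u e')).card
      + ((P h).filter (fun u => u ∉ W ∧ adj e u)).card → False
  cmp' : ∀ e e', e ∉ W → e' ∉ W → (∀ g, e ∉ P g) → (∀ g, e' ∉ P g) → ∀ g h,
    ((P g).filter (fun u => u ∉ W ∧ adj u e)).card
      + (2 * k + 6) ≤ ((P g).filter (fun u => u ∉ W ∧ adj u e')).card →
    ((P h).filter (fun u => u ∉ W ∧ adj u e')).card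
      + (2 * k + 6) ≤ ((P h).filter (fun u => u ∉ W ∧ adj u e)).card → False

lemma chain_pred {V : Type*} {r : V → V → Prop} {l : List V} {x : V} (hl : l.IsChain r)
    (hx : l.head? = some x) {v : V} (hv : v ∈ l) : v = x ∨ ∃ u ∈ l, r u v := by
  obtain ⟨i, hi, rfl⟩ := List.mem_iff_getElem.1 hv
  cases i with
  | zero =>
    left
    rw [List.head?_eq_getElem?, List.getElem?_eq_getElem hi] at hx
    simpa using hx
  | succ i =>
    right
    exact ⟨l[i], List.getElem_mem _, List.isChain_iff_getElem.1 hl i hi⟩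

lemma chain_succ {V : Type*} {r : V → V → Prop} {l : List V} {x : V} (hl : l.IsChain r)
    (hx : l.getLast? = some x) {v : V} (hv : v ∈ l) : v = x ∨ ∃ u ∈ l, r v u := by
  obtain ⟨i, hi, rfl⟩ := List.mem_iff_getElem.1 hv
  by_cases h : i + 1 < l.length
  · right
    exact ⟨l[i + 1], List.getElem_mem _, List.isChain_iff_getElem.1 hl i h⟩
  · left
    rw [List.getLast?_eq_getElem?] at hx
    have : l.length - 1 = i := by omega
    rw [this, List.getElem?_eq_getElem hi] at hx
    simpa using hx

lemma chain_reach {V : Type*} {r adj : V → V → Prop} (hr : ∀ u v, r u v → adj u v) (U : Set V)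
    (l : List V) {x y : V} (hp : PT r x y l)
    (hU : ∀ v ∈ l, v ∈ U) : ReachIn adj U x y := by
  induction l generalizing x with
  | nil => simp [PT] at hp
  | cons z l ih =>
    have hz : z = x := by simpa [PT] using hp.1
    subst hz
    cases l with
    | nil =>
      have : z = y := by simpa [PT] using hp.2.1
      subst this
      exact Relation.ReflTransGen.refl
    | cons w l =>
      have h3 := hp.2.2
      rw [List.isChain_cons_cons] at h3
      refine Relation.ReflTransGen.head ⟨hU z (by simp), hU w (by simp), hr _ _ h3.1⟩ ?_
      refine ih ⟨by simp, ?_, h3.2⟩ (fun v hv => hU v (by simp at hv ⊢; tauto))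
      have := hp.2.1
      rwa [List.getLast?_cons_cons] at this

section st3
variable {adj : V → V → Prop} {k N K d D : ℕ} {A B : Fin N → Finset V} {a b : Fin N → V}
  {Em Ep W0 : Finset V} {RA RB Fp Fm : Fin N → Finset V} {W : Finset V}

lemma sep (h : Dat adj k N K d D A B a b Em Ep W0)
    (h2 : Dat2 adj k N A B a b Em Ep W0 RA RB Fp Fm W) (hW : W.card + N ≤ K)
    (hconn : ∀ S : Finset V, S.card < K → StrConnOn adj (Set.univ \ (S : Set V)))
    (S : Finset V) (hS : S.card < N) : ∃ i j, a i ∉ S ∧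
      Relation.ReflTransGen (fun u v => rr adj a b Fp Fm W u v ∧ u ∉ S ∧ v ∉ S) (a i) (b j) := by
  obtain ⟨g, hg⟩ := pigeon RA h2.disjRA S hS
  obtain ⟨h', hh⟩ := pigeon RB h2.disjRB S hS
  have hk := h.hk
  obtain ⟨f, hf⟩ : (Fp g).Nonempty := by rw [← Finset.card_pos, h2.Fpc]; omega
  obtain ⟨f', hf'⟩ : (Fm h').Nonempty := by rw [← Finset.card_pos, h2.Fmc]; omega
  have hWS : (W ∪ S).card < K := by have := Finset.card_union_le W S; omega
  obtain ⟨u, hu, huS⟩ := Finset.exists_mem_notMem_of_card_lt_card (hWS.trans_le (h.outd f))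
  obtain ⟨w, hw, hwS⟩ := Finset.exists_mem_notMem_of_card_lt_card (hWS.trans_le (h.ind f'))
  rw [mem_oN] at hu hw
  have hr := hconn (W ∪ S) hWS u (by simpa using huS) w (by simpa using hwS)
  simp only [Finset.mem_union, not_or] at huS hwS
  have haS : a g ∉ S := hg _ (h2.ARA g (h.aA g))
  have hbS : b h' ∉ S := hh _ (h2.BRB h' (h.bB h'))
  have hfS : f ∉ S := hg _ (h2.FpRA g hf)
  have hfS' : f' ∉ S := hh _ (h2.FmRB h' hf')
  refine ⟨g, h', haS, ?_⟩
  refine Relation.ReflTransGen.head (b := f) ⟨⟨h2.Fpa g f hf, Or.inl ⟨g, rfl, hf⟩⟩, haS, hfS⟩ ?_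
  refine Relation.ReflTransGen.head (b := u)
    ⟨⟨hu, Or.inr (Or.inl ⟨g, hf, huS.1⟩)⟩, hfS, huS.2⟩ ?_
  have hmid : Relation.ReflTransGen (fun u v => rr adj a b Fp Fm W u v ∧ u ∉ S ∧ v ∉ S) u w := by
    unfold ReachIn at hr
    clear hw hwS
    induction hr with
    | refl => exact Relation.ReflTransGen.refl
    | tail _ hab ih =>
      have h1 := hab.1
      have h2 := hab.2.1
      simp at h1 h2
      exact Relation.ReflTransGen.tail ih ⟨⟨hab.2.2, Or.inr (Or.inr (Or.inl ⟨h1.1, h2.1⟩))⟩,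
        h1.2, h2.2⟩
  refine hmid.trans ?_
  refine Relation.ReflTransGen.head (b := f')
    ⟨⟨hw, Or.inr (Or.inr (Or.inr (Or.inl ⟨h', hwS.1, hf'⟩)))⟩, hwS.2, hfS'⟩ ?_
  exact Relation.ReflTransGen.single ⟨⟨h2.Fmb h' f' hf',
    Or.inr (Or.inr (Or.inr (Or.inr ⟨h', hf', rfl⟩)))⟩, hfS', hbS⟩

lemma step3 (h : Dat adj k N K d D A B a b Em Ep W0)
    (h2 : Dat2 adj k N A B a b Em Ep W0 RA RB Fp Fm W) (hW : W.card + N ≤ K)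
    (hconn : ∀ S : Finset V, S.card < K → StrConnOn adj (Set.univ \ (S : Set V))) :
    ∃ P σ x y, Dat3 adj k N a b Fp Fm W P σ x y := by
  have hAu : ∀ {v g g'}, v ∈ RA g → v ∈ RA g' → g = g' := by
    intro v g g' h1 h1'
    by_contra hne
    exact Finset.disjoint_left.1 (h2.disjRA _ _ hne) h1 h1'
  have hBu : ∀ {v g g'}, v ∈ RB g → v ∈ RB g' → g = g' := by
    intro v g g' h1 h1'
    by_contra hne
    exact Finset.disjoint_left.1 (h2.disjRB _ _ hne) h1 h1'
  have hABu : ∀ {v g g'}, v ∈ RA g → v ∉ RB g' := fun h1 => Finset.disjoint_left.1 (h2.disjRAB _ _) h1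
  have haR : ∀ g, a g ∈ RA g := fun g => h2.ARA g (h.aA g)
  have hbR : ∀ g, b g ∈ RB g := fun g => h2.BRB g (h.bB g)
  have haW : ∀ g, a g ∈ W := fun g => h2.RAW g (haR g)
  have hbW : ∀ g, b g ∈ W := fun g => h2.RBW g (hbR g)
  have hfR : ∀ {v g}, v ∈ Fp g → v ∈ RA g := fun hv => h2.FpRA _ hv
  have hfR' : ∀ {v g}, v ∈ Fm g → v ∈ RB g := fun hv => h2.FmRB _ hv
  have hfW : ∀ {v g}, v ∈ Fp g → v ∈ W := fun hv => h2.RAW _ (hfR hv)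
  have hfW' : ∀ {v g}, v ∈ Fm g → v ∈ W := fun hv => h2.RBW _ (hfR' hv)
  have haf : ∀ g g', a g ∉ Fp g' := by
    intro g g' hm
    have := hAu (haR g) (hfR hm)
    subst this
    exact h.tour.1 _ (h2.Fpa g _ hm)
  have hbf : ∀ g g', b g ∉ Fm g' := by
    intro g g' hm
    have := hBu (hbR g) (hfR' hm)
    subst this
    exact h.tour.1 _ (h2.Fmb g _ hm)
  have hainj : Function.Injective a := fun g g' e => hAu (haR g) (e ▸ haR g')
  have hbinj : Function.Injective b := fun g g' e => hBu (hbR g) (e ▸ hbR g')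
  obtain ⟨P, hP⟩ := exists_msys (menger _ a b hainj (sep h h2 hW hconn))
  choose σ hσ using hP.1.1
  have hPu : ∀ {v g g'}, v ∈ P g → v ∈ P g' → g = g' := by
    intro v g g' h1 h1'
    by_contra hne
    exact hP.1.2 _ _ hne v h1 h1'
  have haP : ∀ g, a g ∈ P g := fun g => List.mem_of_head? (hσ g).1
  have hbP : ∀ g, b (σ g) ∈ P g := fun g => List.mem_of_getLast? (hσ g).2.1
  have hσi : Function.Injective σ := fun g g' e => hPu (hbP g) (e ▸ hbP g')
  have hσb : Function.Bijective σ := Finite.injective_iff_bijective.1 hσi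
  have fA : ∀ {g g'}, a g' ∈ P g → g' = g := fun hm => hPu (haP _) hm
  have fB : ∀ {g g'}, b g' ∈ P g → g' = σ g := by
    intro g g' hm
    obtain ⟨i, rfl⟩ := hσb.2 g'
    rw [hPu (hbP i) hm]
  have fFp : ∀ {f g g'}, f ∈ Fp g' → f ∈ P g → g' = g := by
    intro f g g' hf hfP
    rcases chain_pred (hσ g).2.2 (hσ g).1 hfP with rfl | ⟨u, hu, -, hr⟩
    · exact absurd hf (haf _ _)
    · rcases hr with ⟨i, rfl, hi⟩ | ⟨i, -, hi⟩ | ⟨-, hi⟩ | ⟨i, -, hi⟩ | ⟨i, -, rfl⟩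
      · rw [hAu (hfR hf) (hfR hi)]; exact fA hu
      · exact absurd (hfW hf) hi
      · exact absurd (hfW hf) hi
      · exact absurd (hfR' hi) (hABu (hfR hf))
      · exact absurd (hbR i) (hABu (hfR hf))
  have fFm : ∀ {f g g'}, f ∈ Fm g' → f ∈ P g → g' = σ g := by
    intro f g g' hf hfP
    rcases chain_succ (hσ g).2.2 (hσ g).2.1 hfP with rfl | ⟨u, hu, -, hr⟩
    · exact absurd hf (hbf _ _)
    · rcases hr with ⟨i, rfl, hi⟩ | ⟨i, hi, -⟩ | ⟨hi, -⟩ | ⟨i, hi, -⟩ | ⟨i, hi, rfl⟩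
      · exact absurd (hfR' hf) (hABu (haR i))
      · exact absurd (hfR' hf) (hABu (hfR hi))
      · exact absurd (hfW' hf) hi
      · exact absurd (hfW' hf) hi
      · rw [hBu (hfR' hf) (hfR' hi)]; exact fB hu
  have hPW : ∀ g, ∀ v ∈ P g, v ∈ W → v = a g ∨ v ∈ Fp g ∨ v ∈ Fm (σ g) ∨ v = b (σ g) := by
    intro g v hv hvW
    rcases chain_pred (hσ g).2.2 (hσ g).1 hv with rfl | ⟨u, hu, -, hr⟩
    · exact Or.inl rfl
    · rcases hr with ⟨i, rfl, hi⟩ | ⟨i, -, hi⟩ | ⟨-, hi⟩ | ⟨i, -, hi⟩ | ⟨i, -, rfl⟩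
      · exact Or.inr (Or.inl (fFp hi hv ▸ hi))
      · exact absurd hvW hi
      · exact absurd hvW hi
      · exact Or.inr (Or.inr (Or.inl (fFm hi hv ▸ hi)))
      · exact Or.inr (Or.inr (Or.inr (by rw [fB hv])))
  have hlen : ∀ g, (P g).length = (P g).toFinset.card := fun g =>
    (List.toFinset_card_of_nodup (hP.nodup g)).symm
  have hPl : ∀ g e, e ∉ W → e ∉ P g → (P g).length ≤
      ((P g).toFinset.filter (fun u => u ∉ W ∧ adj u e)).card +
      ((P g).toFinset.filter (fun u => u ∉ W ∧ adj e u)).card + (2 * k + 2) := by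
    intro g e heW heP
    have hsub : (P g).toFinset ⊆ ((P g).toFinset.filter (fun u => u ∉ W ∧ adj u e) ∪
      (P g).toFinset.filter (fun u => u ∉ W ∧ adj e u)) ∪ ((Fp g ∪ Fm (σ g)) ∪ {a g, b (σ g)}) := by
      intro v hv
      have hv' := List.mem_toFinset.1 hv
      simp only [Finset.mem_union, Finset.mem_filter, hv, true_and, Finset.mem_insert,
        Finset.mem_singleton]
      by_cases hvW : v ∈ W
      · have := hPW g v hv' hvW
        tauto
      · have := h.tour.2.2 v e (fun e' => heP (e' ▸ hv'))
        tauto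
    have c0 := Finset.card_le_card hsub
    have c1 := Finset.card_union_le ((P g).toFinset.filter (fun u => u ∉ W ∧ adj u e) ∪
      (P g).toFinset.filter (fun u => u ∉ W ∧ adj e u)) ((Fp g ∪ Fm (σ g)) ∪ {a g, b (σ g)})
    have c2 := Finset.card_union_le ((P g).toFinset.filter (fun u => u ∉ W ∧ adj u e))
      ((P g).toFinset.filter (fun u => u ∉ W ∧ adj e u))
    have c3 := Finset.card_union_le (Fp g ∪ Fm (σ g)) {a g, b (σ g)}
    have c4 := Finset.card_union_le (Fp g) (Fm (σ g))
    have c5 := Finset.card_le_two (a := a g) (b := b (σ g))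
    rw [h2.Fpc, h2.Fmc] at c4
    rw [hlen]
    omega
  have hcnt : ∀ g (q q' : V → Prop) [DecidablePred q], (∀ u, q u → q' u) →
      ((P g).toFinset.filter q).card ≤ ((P g).filter (fun u => q' u)).length := by
    intro g q q' _ hq
    refine le_trans (Finset.card_le_card (t := ((P g).filter (fun u => q' u)).toFinset) ?_)
      (List.toFinset_card_le _)
    intro u hu
    simp only [Finset.mem_filter, List.mem_toFinset, List.mem_filter, decide_eq_true_eq] at hu ⊢
    exact ⟨hu.1, hq u hu.2⟩
  have hswap : ∀ e e', e ∉ W → e' ∉ W → e ≠ e' → (∀ g, e ∉ P g) → (∀ g, e' ∉ P g) → ∀ g h, g ≠ h →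
      (P g).length + 4 ≤ ((P g).toFinset.filter (fun u => u ∉ W ∧ adj u e)).card +
        ((P g).toFinset.filter (fun u => u ∉ W ∧ adj e' u)).card →
      (P h).length + 4 ≤ ((P h).toFinset.filter (fun u => u ∉ W ∧ adj u e')).card +
        ((P h).toFinset.filter (fun u => u ∉ W ∧ adj e u)).card → False := by
    intro e e' heW heW' hee he he' g h hgh c1 c2
    have q1 : ∀ e, e ∉ W → ∀ u, (u ∉ W ∧ adj u e) → rr adj a b Fp Fm W u e :=
      fun e he u hu => ⟨hu.2, Or.inr (Or.inr (Or.inl ⟨hu.1, he⟩))⟩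
    have q2 : ∀ e, e ∉ W → ∀ u, (u ∉ W ∧ adj e u) → rr adj a b Fp Fm W e u :=
      fun e he u hu => ⟨hu.2, Or.inr (Or.inr (Or.inl ⟨he, hu.1⟩))⟩
    exact swapF hP g h hgh e e' hee he he'
      (c1.trans (add_le_add (hcnt g _ _ (q1 e heW)) (hcnt g _ _ (q2 e' heW'))))
      (c2.trans (add_le_add (hcnt h _ _ (q1 e' heW')) (hcnt h _ _ (q2 e heW))))
  refine ⟨fun g => (P g).toFinset, σ, fun g => (P g).getD 2 (a g),
    fun g => (P g).getD ((P g).length - 3) (a g), ?_⟩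
  refine ⟨fun g => List.mem_toFinset.2 (haP g), fun g => List.mem_toFinset.2 (hbP g), ?_, ?_, hσb,
    ?_, ?_, ?_, ?_, ?_⟩
  · intro g
    exact chain_reach (fun u v huv => huv.1) _ _ (hσ g) (by simp)
  · intro g g' hne
    rw [Finset.disjoint_left]
    intro v hv hv'
    exact hP.1.2 g g' hne v (List.mem_toFinset.1 hv) (List.mem_toFinset.1 hv')
  · intro g v hv
    exact hPW g v (List.mem_toFinset.1 hv)
  · intro g v hv hvW hvx f hf
    by_contra hvf
    have hvP := List.mem_toFinset.1 hv
    have hfv : adj f v := by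
      rcases h.tour.2.2 v f (fun e => hvW (e ▸ hfW hf)) with h | h
      · exact absurd h hvf
      · exact h
    obtain ⟨j, hj, rfl⟩ := List.mem_iff_getElem.1 hvP
    have hl := repl1 hP g (σ g) _ (pt_front (hσ g) j hj (a := a g) (f := f)
      ⟨h2.Fpa g f hf, Or.inl ⟨g, rfl, hf⟩⟩ ⟨hfv, Or.inr (Or.inl ⟨g, hf, hvW⟩)⟩) (by
        intro w hw g' hg'
        simp only [List.mem_cons] at hw
        rcases hw with rfl | rfl | hw
        · exact (fA hg').symm
        · exact (fFp hf hg').symm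
        · exact hPu hg' (List.mem_of_mem_drop hw))
    simp only [List.length_cons, List.length_drop] at hl
    have h0 : ∀ h0 : 0 < (P g).length, (P g)[0] = a g := by
      intro h0
      have := (hσ g).1
      rw [List.head?_eq_getElem?, List.getElem?_eq_getElem h0] at this
      simpa using this
    have hj3 : j = 0 ∨ j = 1 ∨ j = 2 := by omega
    rcases hj3 with rfl | rfl | rfl
    · exact hvW (by rw [h0]; exact haW g)
    · have hr := (List.isChain_iff_getElem.1 (hσ g).2.2 0 hj).2
      rw [h0] at hr
      rcases hr with ⟨i, -, hi⟩ | ⟨i, hi, -⟩ | ⟨hi, -⟩ | ⟨i, hi, -⟩ | ⟨i, hi, -⟩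
      · exact hvW (hfW hi)
      · exact haf _ _ hi
      · exact hi (haW g)
      · exact hi (haW g)
      · exact hABu (haR g) (hfR' hi)
    · apply hvx
      simp [List.getD_eq_getElem?_getD, List.getElem?_eq_getElem hj]
  · intro g v hv hvW hvx f hf
    by_contra hvf
    have hvP := List.mem_toFinset.1 hv
    have hfv : adj v f := by
      rcases h.tour.2.2 v f (fun e => hvW (e ▸ hfW' hf)) with h | h
      · exact h
      · exact absurd h hvf
    obtain ⟨j, hj, rfl⟩ := List.mem_iff_getElem.1 hvP
    have hl := repl1 hP g (σ g) _ (pt_back (hσ g) j hj (b := b (σ g)) (f := f)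
      ⟨hfv, Or.inr (Or.inr (Or.inr (Or.inl ⟨σ g, hvW, hf⟩)))⟩
      ⟨h2.Fmb _ f hf, Or.inr (Or.inr (Or.inr (Or.inr ⟨σ g, hf, rfl⟩)))⟩) (by
        intro w hw g' hg'
        simp only [List.mem_append, List.mem_cons, List.not_mem_nil, or_false] at hw
        rcases hw with hw | rfl | rfl
        · exact hPu hg' (List.mem_of_mem_take hw)
        · exact hσi (fFm hf hg').symm
        · exact hσi (fB hg').symm)
    simp only [List.length_append, List.length_take, List.length_cons, List.length_nil] at hl
    have h0 : ∀ h0 : (P g).length - 1 < (P g).length, (P g)[(P g).length - 1] = b (σ g) := by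
      intro h0
      have := (hσ g).2.1
      rw [List.getLast?_eq_getElem?, List.getElem?_eq_getElem h0] at this
      simpa using this
    have hj3 : j = (P g).length - 1 ∨ j + 1 = (P g).length - 1 ∨ j = (P g).length - 3 := by omega
    rcases hj3 with hj3 | hj3 | hj3
    · subst hj3
      exact hvW (by rw [h0]; exact hbW _)
    · have hr := (List.isChain_iff_getElem.1 (hσ g).2.2 j (by omega)).2
      have h1 : (P g)[j + 1]'(by omega) = b (σ g) := by
        rw [← h0 (by omega)]; congr 1
      rw [h1] at hr
      rcases hr with ⟨i, hi, -⟩ | ⟨i, hi, -⟩ | ⟨-, hi⟩ | ⟨i, -, hi⟩ | ⟨i, hi, -⟩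
      · exact hvW (hi ▸ haW i)
      · exact hvW (hfW hi)
      · exact hi (hbW _)
      · exact hbf _ _ hi
      · exact hvW (hfW' hi)
    · apply hvx
      subst hj3
      simp [List.getD_eq_getElem?_getD, List.getElem?_eq_getElem hj]
  · intro e e' heW heW' he he' g g' c1 c2
    simp only [List.mem_toFinset] at he he'
    have p1 := hPl g e heW (he g)
    have p2 := hPl g' e' heW' (he' g')
    refine hswap e e' heW heW' ?_ he he' g g' ?_ (by omega) (by omega)
    · rintro rfl; omega
    · rintro rfl; omega
  · intro e e' heW heW' he he' g g' c1 c2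
    simp only [List.mem_toFinset] at he he'
    have p1 := hPl g e heW (he g)
    have p2 := hPl g' e' heW' (he' g')
    refine hswap e' e heW' heW ?_ he' he g g' ?_ (by omega) (by omega)
    · rintro rfl; omega
    · rintro rfl; omega

end st3

structure Dat5 {V : Type*} [Fintype V] (adj : V → V → Prop) (k N : ℕ) (Em Ep W0 W : Finset V)
    (P : Fin N → Finset V) (x y : Fin N → V) (Gr : Fin N → Finset V)
    (hs : Fin N → Finset (Fin N)) : Prop where
  clG : ∀ g, Cl adj k W0 Em Ep (Gr g)
  disjG : ∀ g h, g ≠ h → Disjoint (Gr g) (Gr h)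
  GW : ∀ g, Disjoint (Gr g) W
  cardG : ∀ g, (Gr g).card ≤ 2 * k + k ^ 2
  hs4 : ∀ g, (hs g).card ≤ 4
  ghs : ∀ g, g ∈ hs g
  loc : ∀ g, ∀ u ∈ Gr g, ∀ i, u ∈ P i → i ∈ hs g
  xout : ∀ g, x g ∉ W0 → ∃ s ⊆ Gr g, k ≤ s.card ∧ ∀ u ∈ s, adj (x g) u
  yin : ∀ g, y g ∉ W0 → ∃ s ⊆ Gr g, k ≤ s.card ∧ ∀ u ∈ s, adj u (y g)

section st5
variable {adj : V → V → Prop} {k N K d D : ℕ} {A B : Fin N → Finset V} {a b : Fin N → V}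
  {Em Ep W0 : Finset V}

lemma fiber {β : Type*} [Fintype β] (f : V → β) (s : Finset V) (n : ℕ) (β0 : β)
    (h : Fintype.card β * n ≤ s.card) : ∃ y, ∃ T ⊆ s, T.card = n ∧ ∀ v ∈ T, f v = y := by
  obtain ⟨y, -, hy⟩ := Finset.exists_le_card_fiber_of_mul_le_card_of_maps_to
    (s := s) (t := (Finset.univ : Finset β)) (f := f) (n := n) (fun _ _ => Finset.mem_univ _)
    ⟨β0, Finset.mem_univ _⟩ (by simpa using h)
  obtain ⟨T, hT, hc⟩ := Finset.exists_subset_card_eq hy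
  refine ⟨y, T, hT.trans (Finset.filter_subset _ _), hc, fun v hv => ?_⟩
  exact (Finset.mem_filter.1 (hT hv)).2

lemma Dat.resIn (h : Dat adj k N K d D A B a b Em Ep W0) (loc : V → Option (Fin N)) (F : Finset V)
    (hF : 2 * F.card + 2 * ((N + 1) * (N + 1) * k) ≤ K) (z : V) (hz : z ∉ W0) :
    ∃ (c : Option (Fin N)) (s : Finset V), s.card = k ∧
      (∀ w ∈ s, adj w z ∧ w ∉ F ∧ w ∉ Em ∧ w ∉ Ep ∧ loc w = c) := by
  have h1 := h.ind' z hz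
  have := h.Kd
  have := h.dD
  have := h.Em8
  have := h.Ep8
  have e1 := Finset.card_union_le F (Em ∪ Ep)
  have e2 := Finset.card_union_le Em Ep
  have e3 := Finset.le_card_sdiff (F ∪ (Em ∪ Ep)) (oN (flip adj) z)
  have e4 : (N + 1) * k ≤ (N + 1) * (N + 1) * k := by
    have : (N+1) * 1 ≤ (N + 1) * (N + 1) := Nat.mul_le_mul_left _ (by omega)
    exact Nat.mul_le_mul_right _ (by simpa using this)
  obtain ⟨c, T, hT, hc, hTl⟩ := fiber loc (oN (flip adj) z \ (F ∪ (Em ∪ Ep))) k none (by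
    simp only [Fintype.card_option, Fintype.card_fin]
    omega)
  refine ⟨c, T, hc, fun w hw => ?_⟩
  have h3 := hT hw
  simp only [Finset.mem_sdiff, Finset.mem_union, not_or] at h3
  exact ⟨(mem_oN (flip adj) w z).1 h3.1, h3.2.1, h3.2.2.1, h3.2.2.2, hTl w hw⟩

lemma Dat.resOut (h : Dat adj k N K d D A B a b Em Ep W0) (loc : V → Option (Fin N)) (F : Finset V)
    (hWF : W0 ⊆ F)
    (hF : 2 * F.card + 2 * ((N + 1) * (N + 1) * k) ≤ K) (x : V) (hx : x ∉ W0) :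
    ∃ (c c' : Option (Fin N)) (s G : Finset V), s ⊆ G ∧ s.card = k ∧ (∀ z ∈ s, adj x z) ∧
      Cl adj k W0 Em Ep G ∧ G.card ≤ k + k * k ∧
      (∀ w ∈ G, w ∉ F ∧ (loc w = c ∨ loc w = c')) := by
  have h1 := h.outd' x hx
  have := h.Kd
  have := h.Em8
  have e1 := Finset.card_union_le F Em
  have e3 := Finset.le_card_sdiff (F ∪ Em) (oN adj x)
  have hO : ∀ z ∈ oN adj x \ (F ∪ Em), adj x z ∧ z ∉ F ∧ z ∉ Em := by
    intro z hz
    simp only [Finset.mem_sdiff, Finset.mem_union, not_or, mem_oN] at hz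
    exact hz
  choose! ψ I hI1 hI2 using fun z (hz : z ∈ oN adj x \ (F ∪ Em)) =>
    h.resIn loc F hF z (fun hh => (hO z hz).2.1 (hWF hh))
  obtain ⟨⟨c, c'⟩, T, hT, hc, hTl⟩ := fiber (fun z => (loc z, ψ z)) (oN adj x \ (F ∪ Em)) k
    (none, none) (by
      simp only [Fintype.card_prod, Fintype.card_option, Fintype.card_fin]
      omega)
  simp only [Prod.mk.injEq] at hTl
  have hsub : T ⊆ T.biUnion (fun z => insert z (I z)) := fun z hz =>
    Finset.mem_biUnion.2 ⟨z, hz, Finset.mem_insert_self _ _⟩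
  refine ⟨c, c', T, T.biUnion (fun z => insert z (I z)), hsub, hc, fun z hz => (hO z (hT hz)).1,
    ?_, ?_, ?_⟩
  · refine Cl.bi _ _ (fun z hz => ?_)
    have hzO := hO z (hT hz)
    have hI := hI2 z (hT hz)
    exact Cl.add (Cl.free (I z) (fun v hv => ⟨fun hh => (hI v hv).2.1 (hWF hh), (hI v hv).2.2.1,
      (hI v hv).2.2.2.1⟩)) z ∅ (I z) (Or.inl ⟨fun hh => hzO.2.1 (hWF hh), hzO.2.2⟩)
      (Or.inr ⟨subset_rfl, (hI1 z (hT hz)).ge, fun u hu => (hI u hu).1⟩)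
  · have := Finset.card_biUnion_le_card_mul T (fun z => insert z (I z)) (k + 1) (fun z hz =>
      (Finset.card_insert_le _ _).trans (by rw [hI1 z (hT hz)]))
    rw [hc] at this
    nlinarith
  · intro w hw
    rw [Finset.mem_biUnion] at hw
    obtain ⟨z, hz, hw⟩ := hw
    rcases Finset.mem_insert.1 hw with rfl | hw
    · exact ⟨(hO _ (hT hz)).2.1, Or.inl (hTl _ hz).1⟩
    · have := hI2 z (hT hz) w hw
      exact ⟨this.2.1, Or.inr (this.2.2.2.2.trans (hTl z hz).2)⟩

lemma Dat.res (h : Dat adj k N K d D A B a b Em Ep W0) (loc : V → Option (Fin N)) (F : Finset V)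
    (hWF : W0 ⊆ F)
    (hF : 2 * F.card + 2 * ((N + 1) * (N + 1) * k) ≤ K) (x y : V) :
    ∃ (G : Finset V), G.card ≤ 2 * k + k ^ 2 ∧ Disjoint G F ∧ Cl adj k W0 Em Ep G ∧
      (x ∉ W0 → ∃ s ⊆ G, k ≤ s.card ∧ ∀ u ∈ s, adj x u) ∧
      (y ∉ W0 → ∃ s ⊆ G, k ≤ s.card ∧ ∀ u ∈ s, adj u y) ∧
      ∃ hh : Finset (Fin N), hh.card ≤ 3 ∧ ∀ u ∈ G, ∀ i, loc u = some i → i ∈ hh := by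
  have hX : ∃ (hh : Finset (Fin N)) (G : Finset V), hh.card ≤ 2 ∧ Cl adj k W0 Em Ep G ∧
      G.card ≤ k + k * k ∧ (x ∉ W0 → ∃ s ⊆ G, k ≤ s.card ∧ ∀ u ∈ s, adj x u) ∧
      (∀ w ∈ G, w ∉ F ∧ ∀ i, loc w = some i → i ∈ hh) := by
    by_cases hx : x ∈ W0
    · exact ⟨∅, ∅, by simp, Cl.empty, by simp, fun h => absurd hx h, by simp⟩
    · obtain ⟨c, c', s, G, h1, h2, h3, h4, h5, h6⟩ := h.resOut loc F hWF hF x hx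
      refine ⟨c.toFinset ∪ c'.toFinset, G, ?_, h4, h5, fun _ => ⟨s, h1, h2.ge, h3⟩, ?_⟩
      · refine (Finset.card_union_le _ _).trans ?_
        have hle : ∀ c : Option (Fin N), c.toFinset.card ≤ 1 := by intro c; cases c <;> simp
        have := hle c
        have := hle c'
        omega
      · intro w hw
        refine ⟨(h6 w hw).1, fun i hi => ?_⟩
        rcases (h6 w hw).2 with e | e <;> simp [← e, hi]
  have hY : ∃ (hh : Finset (Fin N)) (G : Finset V), hh.card ≤ 1 ∧ Cl adj k W0 Em Ep G ∧
      G.card ≤ k ∧ (y ∉ W0 → ∃ s ⊆ G, k ≤ s.card ∧ ∀ u ∈ s, adj u y) ∧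
      (∀ w ∈ G, w ∉ F ∧ ∀ i, loc w = some i → i ∈ hh) := by
    by_cases hy : y ∈ W0
    · exact ⟨∅, ∅, by simp, Cl.empty, by simp, fun h => absurd hy h, by simp⟩
    · obtain ⟨c, s, h1, h2⟩ := h.resIn loc F hF y hy
      refine ⟨c.toFinset, s, ?_, Cl.free s (fun v hv => ⟨fun hh => (h2 v hv).2.1 (hWF hh),
        (h2 v hv).2.2.1, (h2 v hv).2.2.2.1⟩), h1.le,
        fun _ => ⟨s, subset_rfl, h1.ge, fun u hu => (h2 u hu).1⟩, ?_⟩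
      · cases c <;> simp
      · intro w hw
        refine ⟨(h2 w hw).2.1, fun i hi => ?_⟩
        simp [← (h2 w hw).2.2.2.2, hi]
  obtain ⟨hh, G, a1, a2, a3, a4, a5⟩ := hX
  obtain ⟨hh', G', b1, b2, b3, b4, b5⟩ := hY
  refine ⟨G ∪ G', ?_, ?_, Cl.un a2 b2, ?_, ?_, hh ∪ hh', ?_, ?_⟩
  · refine (Finset.card_union_le _ _).trans ?_
    nlinarith
  · rw [Finset.disjoint_left]
    intro w hw
    rcases Finset.mem_union.1 hw with hw | hw
    · exact (a5 w hw).1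
    · exact (b5 w hw).1
  · intro hx
    obtain ⟨s, hs, h'⟩ := a4 hx
    exact ⟨s, hs.trans Finset.subset_union_left, h'⟩
  · intro hx
    obtain ⟨s, hs, h'⟩ := b4 hx
    exact ⟨s, hs.trans Finset.subset_union_right, h'⟩
  · exact (Finset.card_union_le _ _).trans (by omega)
  · intro w hw i hi
    rcases Finset.mem_union.1 hw with hw | hw
    · exact Finset.mem_union_left _ ((a5 w hw).2 i hi)
    · exact Finset.mem_union_right _ ((b5 w hw).2 i hi)

lemma step5 (h : Dat adj k N K d D A B a b Em Ep W0) (W : Finset V) (hW : W0 ⊆ W)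
    (P : Fin N → Finset V) (hP : ∀ g h, g ≠ h → Disjoint (P g) (P h)) (x y : Fin N → V)
    (hK : 2 * (W.card + N * (2 * k + k ^ 2)) + 2 * ((N + 1) * (N + 1) * k) ≤ K) :
    ∃ Gr hs, Dat5 adj k N Em Ep W0 W P x y Gr hs := by
  let loc : V → Option (Fin N) := fun v => if hv : ∃ g, v ∈ P g then some hv.choose else none
  have hloc : ∀ v i, v ∈ P i → loc v = some i := by
    intro v i hi
    have hv : ∃ g, v ∈ P g := ⟨i, hi⟩
    simp only [loc, dif_pos hv]
    congr 1
    by_contra hne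
    exact Finset.disjoint_left.1 (hP _ _ hne) hv.choose_spec hi
  obtain ⟨Gr, F, h1, h2⟩ := greedy (V := V) (Finset.univ : Finset (Fin N)) W (2 * k + k ^ 2)
    (W.card + N * (2 * k + k ^ 2))
    (fun g _ G => Cl adj k W0 Em Ep G ∧
      (x g ∉ W0 → ∃ s ⊆ G, k ≤ s.card ∧ ∀ u ∈ s, adj (x g) u) ∧
      (y g ∉ W0 → ∃ s ⊆ G, k ≤ s.card ∧ ∀ u ∈ s, adj u (y g)) ∧
      ∃ hh : Finset (Fin N), hh.card ≤ 3 ∧ ∀ u ∈ G, ∀ i, loc u = some i → i ∈ hh)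
    (fun g _ F hWF hF => h.res loc F (hW.trans hWF) (by omega) (x g) (y g)) (by simp)
  have h3 := fun g => (h1 g (Finset.mem_univ _)).2.2.1
  choose c1 c2 c3 hh c4 c5 using h3
  refine ⟨Gr, fun g => insert g (hh g), c1, fun g g' => h2 g (Finset.mem_univ _) g' (Finset.mem_univ _),
    fun g => (h1 g (Finset.mem_univ _)).2.1, fun g => (h1 g (Finset.mem_univ _)).1, ?_, ?_, ?_, c2, c3⟩
  · intro g
    exact (Finset.card_insert_le _ _).trans (by have := c4 g; omega)
  · intro g; exact Finset.mem_insert_self _ _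
  · intro g u hu i hi
    exact Finset.mem_insert_of_mem (c5 g u hu i (hloc u i hi))

end st5

lemma step6 {N : ℕ} (r : V → V → Prop) (P : Fin N → Finset V) (W : Finset V) (K H γ : ℕ)
    (g0 : Fin N) (hγ : 0 < γ) (hKH : 4 * N * H ≤ K)
    (hcmp : ∀ e e', e ∉ W → e' ∉ W → (∀ g, e ∉ P g) → (∀ g, e' ∉ P g) → ∀ g h,
      ((P g).filter (fun u => u ∉ W ∧ r e u)).card + γ
        ≤ ((P g).filter (fun u => u ∉ W ∧ r e' u)).card →
      ((P h).filter (fun u => u ∉ W ∧ r e' u)).card + γ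
        ≤ ((P h).filter (fun u => u ∉ W ∧ r e u)).card → False) :
    ∃ g, ∀ e, e ∉ W → (∀ g, e ∉ P g) →
      K ≤ 4 * (((Finset.univ.biUnion P).filter (fun u => u ∉ W ∧ r e u)).card) →
      H ≤ ((P g).filter (fun u => u ∉ W ∧ r e u)).card + γ * N := by
  obtain ⟨g, hg⟩ := abstract_cmp (fun e g => ((P g).filter (fun u => u ∉ W ∧ r e u)).card) γ H
    (Finset.univ.filter (fun e => e ∉ W ∧ (∀ g, e ∉ P g) ∧
      K ≤ 4 * (((Finset.univ.biUnion P).filter (fun u => u ∉ W ∧ r e u)).card)))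
    (by
      intro e he e' he' g h h1 h2
      simp only [Finset.mem_filter, Finset.mem_univ, true_and] at he he'
      exact hcmp e e' he.1 he'.1 he.2.1 he'.2.1 g h h1 h2)
    (by
      intro e he
      simp only [Finset.mem_filter, Finset.mem_univ, true_and] at he
      by_contra hcon
      push Not at hcon
      have h1 : ((Finset.univ.biUnion P).filter (fun u => u ∉ W ∧ r e u)).card
          ≤ ∑ g, ((P g).filter (fun u => u ∉ W ∧ r e u)).card := by
        rw [Finset.filter_biUnion]
        exact Finset.card_biUnion_le
      have h2 : ∑ g, ((P g).filter (fun u => u ∉ W ∧ r e u)).card < ∑ _g : Fin N, H :=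
        Finset.sum_lt_sum_of_nonempty ⟨g0, Finset.mem_univ _⟩ (fun g _ => hcon g)
      simp only [Finset.sum_const, Finset.card_univ, Fintype.card_fin, smul_eq_mul] at h2
      have := he.2.2
      have e4 : 4 * N * H = 4 * (N * H) := by ring
      omega) g0 hγ
  refine ⟨g, fun e h1 h2 h3 => hg e ?_⟩
  simp only [Finset.mem_filter, Finset.mem_univ, true_and]
  exact ⟨h1, h2, h3⟩

lemma leftGd {N : ℕ} (r : V → V → Prop) (P Gr : Fin N → Finset V) (W W0 E : Finset V)
    (K d H γ M k : ℕ) (hW0 : W0 ⊆ W) (P0 : Fin N)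
    (h0 : ∀ e, e ∉ W → (∀ g, e ∉ P g) →
      K ≤ 4 * (((Finset.univ.biUnion P).filter (fun u => u ∉ W ∧ r e u)).card) →
      H ≤ ((P P0).filter (fun u => u ∉ W ∧ r e u)).card + γ * N)
    (hd : ∀ v, v ∉ W0 → d ≤ (oN r v).card) (hKd : K ≤ d) (hE : 8 * E.card ≤ d)
    (hM : (Finset.univ.biUnion Gr).card ≤ M) (hK : 2 * (W.card + M + k) ≤ K)
    (hH : γ * N + M + k ≤ H) (U : Set V)
    (hU : ∀ u, u ∉ W → (∀ g, u ∉ Gr g) → (∀ g, u ∉ P g) → u ∈ U)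
    (hP : ∀ u ∈ P P0, u ∉ W → (∀ g, u ∉ Gr g) → Gd r k {v | v ∉ W0 ∧ v ∉ E} U u)
    (v : V) (hvW : v ∉ W) (hvG : ∀ g, v ∉ Gr g) (hvP : ∀ g, v ∉ P g) :
    Gd r k {v | v ∉ W0 ∧ v ∉ E} U v := by
  have hvU := hU v hvW hvG hvP
  set GG := Finset.univ.biUnion Gr with hGG
  set PP := Finset.univ.biUnion P with hPP
  have memG : ∀ u, u ∉ GG → ∀ g, u ∉ Gr g := by
    intro u hu g hg; exact hu (by simp only [hGG, Finset.mem_biUnion]; exact ⟨g, by simp, hg⟩)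
  have memP : ∀ u, u ∉ PP → ∀ g, u ∉ P g := by
    intro u hu g hg; exact hu (by simp only [hPP, Finset.mem_biUnion]; exact ⟨g, by simp, hg⟩)
  by_cases hL : k ≤ ((oN r v).filter (fun u => u ∉ W ∧ u ∉ GG ∧ u ∉ PP ∧ u ∉ E)).card
  · refine Gd.step v _ hvU hL ?_ ?_
    · intro u hu
      exact (mem_oN r u v).1 (Finset.mem_filter.1 hu).1
    · intro u hu
      obtain ⟨_, h1, h2, h3, h4⟩ := Finset.mem_filter.1 hu
      exact Gd.base u (hU u h1 (memG u h2) (memP u h3)) ⟨fun h => h1 (hW0 h), h4⟩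
  · have hsub : oN r v ⊆ E ∪ W ∪ GG ∪ PP.filter (fun u => u ∉ W ∧ r v u) ∪
        (oN r v).filter (fun u => u ∉ W ∧ u ∉ GG ∧ u ∉ PP ∧ u ∉ E) := by
      intro u hu
      have := (mem_oN r u v).1 hu
      simp only [Finset.mem_union, Finset.mem_filter]
      tauto
    have hc := Finset.card_le_card hsub
    have u1 := Finset.card_union_le (E ∪ W ∪ GG ∪ PP.filter (fun u => u ∉ W ∧ r v u))
      ((oN r v).filter (fun u => u ∉ W ∧ u ∉ GG ∧ u ∉ PP ∧ u ∉ E))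
    have u2 := Finset.card_union_le (E ∪ W ∪ GG) (PP.filter (fun u => u ∉ W ∧ r v u))
    have u3 := Finset.card_union_le (E ∪ W) GG
    have u4 := Finset.card_union_le E W
    have hdv := hd v (fun h => hvW (hW0 h))
    have h1 := h0 v hvW hvP (by omega)
    have hs2 : (P P0).filter (fun u => u ∉ W ∧ r v u) ⊆
        GG ∪ (P P0).filter (fun u => u ∉ W ∧ u ∉ GG ∧ r v u) := by
      intro u hu
      simp only [Finset.mem_union, Finset.mem_filter] at hu ⊢
      tauto
    have hc2 := Finset.card_le_card hs2
    have u5 := Finset.card_union_le GG ((P P0).filter (fun u => u ∉ W ∧ u ∉ GG ∧ r v u))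
    refine Gd.step v ((P P0).filter (fun u => u ∉ W ∧ u ∉ GG ∧ r v u)) hvU (by omega) ?_ ?_
    · intro u hu
      exact (Finset.mem_filter.1 hu).2.2.2
    · intro u hu
      obtain ⟨h1, h2, h3, _⟩ := Finset.mem_filter.1 hu
      exact hP u h1 h2 (memG u h3)

section asm
variable {adj : V → V → Prop} {k N K d D t : ℕ} {A B : Fin N → Finset V} {a b : Fin N → V}
  {Em Ep W0 : Finset V} {RA RB Fp Fm : Fin N → Finset V} {W : Finset V}
  {P : Fin N → Finset V} {σ : Fin N → Fin N} {x y : Fin N → V} {Gr : Fin N → Finset V}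
  {hs : Fin N → Finset (Fin N)}

lemma nd {s s' : Finset V} {v : V} (h : Disjoint s s') (h1 : v ∈ s) (h2 : v ∈ s') : False :=
  Finset.disjoint_left.1 h h1 h2

lemma colour (h2 : Dat2 adj k N A B a b Em Ep W0 RA RB Fp Fm W)
    (h3 : Dat3 adj k N a b Fp Fm W P σ x y)
    (hbB : ∀ g, b g ∈ RB g) (haA : ∀ g, a g ∈ RA g)
    (h5 : Dat5 adj k N Em Ep W0 W P x y Gr hs) (cl : Fin N → Fin t) (z : Fin t) :
    ∃ C : V → Fin t, ∀ v, (∀ g, v ∈ RA g → C v = cl g) ∧ (∀ g, v ∈ RB (σ g) → C v = cl g) ∧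
      (∀ g, v ∈ Gr g → C v = cl g) ∧ (∀ g, v ∈ P g → (∀ h, v ∉ Gr h) → C v = cl g) ∧
      (v ∉ W → (∀ g, v ∉ Gr g) → (∀ g, v ∉ P g) → C v = z) := by
  suffices hh : ∀ v, ∃ c : Fin t, (∀ g, v ∈ RA g → c = cl g) ∧ (∀ g, v ∈ RB (σ g) → c = cl g) ∧
      (∀ g, v ∈ Gr g → c = cl g) ∧ (∀ g, v ∈ P g → (∀ h, v ∉ Gr h) → c = cl g) ∧
      (v ∉ W → (∀ g, v ∉ Gr g) → (∀ g, v ∉ P g) → c = z) by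
    choose C hC using hh
    exact ⟨C, hC⟩
  intro v
  have hPW : ∀ g, v ∈ P g → v ∈ W → v ∈ RA g ∨ v ∈ RB (σ g) := by
    intro g hg hW
    rcases h3.PW g v hg hW with e | e | e | e
    · left; rw [e]; exact haA g
    · left; exact h2.FpRA g e
    · right; exact h2.FmRB _ e
    · right; rw [e]; exact hbB _
  have eA : ∀ g g', v ∈ RA g → v ∈ RA g' → g = g' := fun g g' h h' => by
    by_contra hne; exact nd (h2.disjRA g g' hne) h h'
  have eB : ∀ g g', v ∈ RB (σ g) → v ∈ RB (σ g') → g = g' := fun g g' h h' => by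
    by_contra hne; exact nd (h2.disjRB (σ g) (σ g') (fun e => hne (h3.bij.1 e))) h h'
  have eG : ∀ g g', v ∈ Gr g → v ∈ Gr g' → g = g' := fun g g' h h' => by
    by_contra hne; exact nd (h5.disjG g g' hne) h h'
  have eP : ∀ g g', v ∈ P g → v ∈ P g' → g = g' := fun g g' h h' => by
    by_contra hne; exact nd (h3.disj g g' hne) h h'
  have eAB : ∀ g g', v ∈ RA g → v ∈ RB g' → False := fun g g' h h' => nd (h2.disjRAB g g') h h'
  have eGW : ∀ g, v ∈ Gr g → v ∈ W → False := fun g h h' => nd (h5.GW g) h h'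
  by_cases c1 : ∃ g, v ∈ RA g
  · obtain ⟨g, hg⟩ := c1
    have hw := h2.RAW g hg
    refine ⟨cl g, fun g' h => by rw [eA g g' hg h], fun g' h => (eAB _ _ hg h).elim,
      fun g' h => (eGW _ h hw).elim, fun g' h _ => ?_, fun h => absurd hw h⟩
    rcases hPW g' h hw with h | h
    · rw [eA g g' hg h]
    · exact (eAB _ _ hg h).elim
  by_cases c2 : ∃ g, v ∈ RB (σ g)
  · obtain ⟨g, hg⟩ := c2
    have hw := h2.RBW _ hg
    refine ⟨cl g, fun g' h => (eAB _ _ h hg).elim, fun g' h => by rw [eB g g' hg h],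
      fun g' h => (eGW _ h hw).elim, fun g' h _ => ?_, fun h => absurd hw h⟩
    rcases hPW g' h hw with h | h
    · exact (eAB _ _ h hg).elim
    · rw [eB g g' hg h]
  push Not at c1 c2
  by_cases c3 : ∃ g, v ∈ Gr g
  · obtain ⟨g, hg⟩ := c3
    exact ⟨cl g, fun g' h => absurd h (c1 g'), fun g' h => absurd h (c2 g'),
      fun g' h => by rw [eG g g' hg h], fun _ _ h => absurd hg (h g), fun _ h => absurd hg (h g)⟩
  push Not at c3
  by_cases c4 : ∃ g, v ∈ P g
  · obtain ⟨g, hg⟩ := c4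
    exact ⟨cl g, fun g' h => absurd h (c1 g'), fun g' h => absurd h (c2 g'),
      fun g' h => absurd h (c3 g'), fun g' h _ => by rw [eP g g' hg h],
      fun _ _ h => absurd hg (h g)⟩
  push Not at c4
  exact ⟨z, fun g' h => absurd h (c1 g'), fun g' h => absurd h (c2 g'),
      fun g' h => absurd h (c3 g'), fun g' h => absurd h (c4 g'), fun _ _ _ => rfl⟩

lemma assemble (hk : 1 ≤ k) (ht : 1 ≤ t) (hN : N = 100 * k * t)
    (h : Dat adj k N K d D A B a b Em Ep W0)
    (h2 : Dat2 adj k N A B a b Em Ep W0 RA RB Fp Fm W)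
    (h3 : Dat3 adj k N a b Fp Fm W P σ x y)
    (h5 : Dat5 adj k N Em Ep W0 W P x y Gr hs) (H : ℕ)
    (n1 : 4 * N * H ≤ K) (n2 : (2 * k + 6) * N + N * (2 * k + k ^ 2) + k ≤ H)
    (n3 : 2 * (W.card + N * (2 * k + k ^ 2) + k) ≤ K) :
    ∃ Q : Fin t → Set V, (⋃ i, Q i) = Set.univ ∧ (Pairwise fun i j => Disjoint (Q i) (Q j)) ∧
      ∀ i, StrKConnOn adj k (Q i) := by
  have hN0 : 0 < N := by rw [hN]; positivity
  let g0 : Fin N := ⟨0, hN0⟩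
  obtain ⟨P0, hP0⟩ := step6 adj P W K H (2 * k + 6) g0 (by omega) n1 (by
    intro e e' h1 h2 h4 h5 g h' h6 h7
    exact h3.cmp e e' h1 h2 h4 h5 g h' (by omega) (by omega))
  obtain ⟨Q0, hQ0⟩ := step6 (flip adj) P W K H (2 * k + 6) g0 (by omega) n1 h3.cmp'
  obtain ⟨ι, cl, hι, hcl, hclP, hclQ⟩ := comb7 k t N hN hk ht hs h5.hs4 h5.ghs P0 Q0 ⟨0, ht⟩
  have haA : ∀ g, a g ∈ RA g := fun g => h2.ARA g (h.aA g)
  have hbB : ∀ g, b g ∈ RB g := fun g => h2.BRB g (h.bB g)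
  obtain ⟨C, hC⟩ := colour h2 h3 hbB haA h5 cl ⟨0, ht⟩
  let U : Fin t → Set V := fun i => {v | C v = i}
  have hUA : ∀ g, (RA g : Set V) ⊆ U (cl g) := fun g v hv => (hC v).1 g hv
  have hUB : ∀ g, (RB (σ g) : Set V) ⊆ U (cl g) := fun g v hv => (hC v).2.1 g hv
  have hUG : ∀ g, (Gr g : Set V) ⊆ U (cl g) := fun g v hv => (hC v).2.2.1 g hv
  have hUP : ∀ g v, v ∈ P g → (∀ h, v ∉ Gr h) → v ∈ U (cl g) := fun g v hv hv' =>
    (hC v).2.2.2.1 g hv hv'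
  have hU0 : ∀ v, v ∉ W → (∀ g, v ∉ Gr g) → (∀ g, v ∉ P g) → v ∈ U ⟨0, ht⟩ := fun v =>
    (hC v).2.2.2.2
  have hM : (Finset.univ.biUnion Gr).card ≤ N * (2 * k + k ^ 2) := by
    refine (Finset.card_biUnion_le_card_mul _ _ _ (fun g _ => h5.cardG g)).trans ?_
    simp
  -- path vertices
  have oP : ∀ g, ∀ v ∈ P g, v ∉ W → (∀ h, v ∉ Gr h) →
      Gd adj k {v | v ∉ W0 ∧ v ∉ Em} (U (cl g)) v := by
    intro g v hv hvW hvG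
    by_cases hx : v = x g
    · obtain ⟨s, s1, s2, s3⟩ := h5.xout g (fun hh => hvW (h2.W0W (hx ▸ hh)))
      refine Gd.step v s (hUP g v hv hvG) s2 (fun u hu => hx ▸ s3 u hu) (fun u hu => ?_)
      exact Gd.mono (hUG g) (h5.clG g u (s1 hu)).1
    · refine Gd.step v (Fp g) (hUP g v hv hvG) (h2.Fpc g).ge (h3.xo g v hv hvW hx)
        (fun u hu => ?_)
      exact Gd.mono (hUA g) (h2.clA g u (h2.FpRA g hu)).1
  have iP : ∀ g, ∀ v ∈ P g, v ∉ W → (∀ h, v ∉ Gr h) →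
      Gd (flip adj) k {v | v ∉ W0 ∧ v ∉ Ep} (U (cl g)) v := by
    intro g v hv hvW hvG
    by_cases hx : v = y g
    · obtain ⟨s, s1, s2, s3⟩ := h5.yin g (fun hh => hvW (h2.W0W (hx ▸ hh)))
      refine Gd.step v s (hUP g v hv hvG) s2 (fun u hu => by rw [hx]; exact s3 u hu)
        (fun u hu => ?_)
      exact Gd.mono (hUG g) (h5.clG g u (s1 hu)).2
    · refine Gd.step v (Fm (σ g)) (hUP g v hv hvG) (h2.Fmc _).ge (h3.yi g v hv hvW hx)
        (fun u hu => ?_)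
      exact Gd.mono (hUB g) (h2.clB _ u (h2.FmRB _ hu)).2
  have all : ∀ v, Gd adj k {v | v ∉ W0 ∧ v ∉ Em} (U (C v)) v ∧
      Gd (flip adj) k {v | v ∉ W0 ∧ v ∉ Ep} (U (C v)) v := by
    intro v
    by_cases hvW : v ∈ W
    · rcases h2.WR v hvW with ⟨g, hg⟩ | ⟨g, hg⟩
      · rw [(hC v).1 g hg]
        exact ⟨Gd.mono (hUA g) (h2.clA g v hg).1, Gd.mono (hUA g) (h2.clA g v hg).2⟩
      · obtain ⟨g, rfl⟩ := h3.bij.2 g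
        rw [(hC v).2.1 g hg]
        exact ⟨Gd.mono (hUB g) (h2.clB _ v hg).1, Gd.mono (hUB g) (h2.clB _ v hg).2⟩
    by_cases hvG : ∃ g, v ∈ Gr g
    · obtain ⟨g, hg⟩ := hvG
      rw [(hC v).2.2.1 g hg]
      exact ⟨Gd.mono (hUG g) (h5.clG g v hg).1, Gd.mono (hUG g) (h5.clG g v hg).2⟩
    push Not at hvG
    by_cases hvP : ∃ g, v ∈ P g
    · obtain ⟨g, hg⟩ := hvP
      rw [(hC v).2.2.2.1 g hg hvG]
      exact ⟨oP g v hg hvW hvG, iP g v hg hvW hvG⟩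
    push Not at hvP
    rw [(hC v).2.2.2.2 hvW hvG hvP]
    constructor
    · exact leftGd adj P Gr W W0 Em K d H (2 * k + 6) _ k h2.W0W P0 hP0 h.outd' h.Kd h.Em8 hM n3 n2
        _ hU0 (by rw [← hclP]; exact oP P0) v hvW hvG hvP
    · exact leftGd (flip adj) P Gr W W0 Ep K D H (2 * k + 6) _ k h2.W0W Q0 hQ0 h.ind'
        (h.Kd.trans h.dD) h.Ep8 hM n3 n2 _ hU0 (by rw [← hclQ]; exact iP Q0) v hvW hvG hvP
  refine ⟨U, ?_, ?_, ?_⟩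
  · ext v; simp [U]
  · intro i j hij
    exact Set.disjoint_left.2 (fun v (h1 : C v = i) (h2 : C v = j) => hij (h1.symm.trans h2))
  intro i
  have hcli : ∀ j, cl (ι (i, j)) = i := fun j => hcl i j _ (h5.ghs _)
  have inj : ∀ j j', j ≠ j' → ι (i, j) ≠ ι (i, j') := fun j j' hne e => hne (by
    have := hι e; simpa using this)
  refine core (Ob := {v | v ∉ W0 ∧ v ∉ Em}) (Ib := {v | v ∉ W0 ∧ v ∉ Ep})
    (fun j => (A (ι (i, j)) : Set V)) (fun j => (B (σ (ι (i, j))) : Set V))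
    (fun j => (A (ι (i, j)) : Set V) ∪ (P (ι (i, j)) : Set V) ∪ (B (σ (ι (i, j))) : Set V))
    ?_ ?_ ?_ ?_ ?_ ?_ ?_ ?_ ?_ ?_
  · set g := ι (i, ⟨0, hk⟩) with hg
    have hsub : ((insert (a g) (Fp g) : Finset V) : Set V) ⊆ U i := by
      intro v hv
      have := hcli ⟨0, hk⟩
      rw [← this]
      apply hUA g
      rw [Finset.mem_coe, Finset.mem_insert] at hv
      rcases hv with rfl | hv
      · exact haA g
      · exact h2.FpRA g hv
    have hni : a g ∉ Fp g := fun hh => h.tour.1 _ (h2.Fpa g _ hh)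
    have := Set.ncard_le_ncard hsub (Set.toFinite _)
    rw [Set.ncard_coe_finset, Finset.card_insert_of_notMem hni, h2.Fpc] at this
    omega
  · intro j v hv
    have hj := hcli j
    rcases hv with (hv | hv) | hv
    · rw [← hj]; exact hUA _ (h2.ARA _ hv)
    · by_cases hvG : ∃ g, v ∈ Gr g
      · obtain ⟨g, hg⟩ := hvG
        have := hcl i j g (h5.loc g v hg _ hv)
        rw [← this]; exact hUG g hg
      · push Not at hvG
        rw [← hj]; exact hUP _ v hv hvG
    · rw [← hj]; exact hUB _ (h2.BRB _ hv)
  · intro j j' hne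
    have hne' := inj j j' hne
    have hσ : σ (ι (i, j)) ≠ σ (ι (i, j')) := fun e => hne' (h3.bij.1 e)
    have hPW : ∀ g, ∀ v ∈ P g, v ∈ W → v ∈ RA g ∨ v ∈ RB (σ g) := by
      intro g v hg hW
      rcases h3.PW g v hg hW with e | e | e | e
      · left; rw [e]; exact haA g
      · left; exact h2.FpRA g e
      · right; exact h2.FmRB _ e
      · right; rw [e]; exact hbB _
    rw [Set.disjoint_left]
    -- membership in an R-set or pure path
    have key : ∀ g v, v ∈ (A g : Set V) ∪ (P g : Set V) ∪ (B (σ g) : Set V) →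
        (v ∈ RA g ∨ v ∈ RB (σ g)) ∨ (v ∈ P g ∧ v ∉ W) := by
      intro g v hv
      rcases hv with (hv | hv) | hv
      · exact Or.inl (Or.inl (h2.ARA g hv))
      · by_cases hw : v ∈ W
        · exact Or.inl (hPW g v hv hw)
        · exact Or.inr ⟨hv, hw⟩
      · exact Or.inl (Or.inr (h2.BRB _ hv))
    intro v hv hv'
    rcases key _ v hv with (e | e) | e <;> rcases key _ v hv' with (e' | e') | e'
    · exact nd (h2.disjRA _ _ hne') e e'
    · exact nd (h2.disjRAB _ _) e e'
    · exact e'.2 (h2.RAW _ e)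
    · exact nd (h2.disjRAB _ _) e' e
    · exact nd (h2.disjRB _ _ hσ) e e'
    · exact e'.2 (h2.RBW _ e)
    · exact e.2 (h2.RAW _ e')
    · exact e.2 (h2.RBW _ e')
    · exact nd (h3.disj _ _ hne') e.1 e'.1
  · intro j v hv; exact Or.inl (Or.inl hv)
  · intro j v hv; exact Or.inr hv
  · intro j u hu v hv
    set g := ι (i, j) with hg
    have r1 : ReachIn adj ((A g : Set V) ∪ (P g : Set V) ∪ (B (σ g) : Set V)) u (a g) := by
      rcases h.sinkA g u hu with e | e
      · rw [e]; exact Relation.ReflTransGen.refl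
      · exact Relation.ReflTransGen.single ⟨Or.inl (Or.inl hu), Or.inl (Or.inl (h.aA g)), e⟩
    have r2 : ReachIn adj ((A g : Set V) ∪ (P g : Set V) ∪ (B (σ g) : Set V)) (b (σ g)) v := by
      rcases h.srcB (σ g) v hv with e | e
      · rw [e]; exact Relation.ReflTransGen.refl
      · exact Relation.ReflTransGen.single ⟨Or.inr (h.bB _), Or.inr hv, e⟩
    have r3 := reach_mono (U' := (A g : Set V) ∪ (P g : Set V) ∪ (B (σ g) : Set V))
      (fun v hv => Or.inl (Or.inr hv)) (h3.reach g)
    exact (r1.trans r3).trans r2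
  · intro v hv j; exact h.domA v hv.1 hv.2 _
  · intro v hv j; exact h.domB v hv.1 hv.2 _
  · intro v (hv : C v = i)
    have := (all v).1
    rwa [hv] at this
  · intro v (hv : C v = i)
    have := (all v).2
    rwa [hv] at this

end asm

lemma two_pow_big (n : ℕ) : 6 ≤ n → 8 * n ≤ 2 ^ n := by
  intro h
  induction n, h using Nat.le_induction with
  | base => norm_num
  | succ n h ih => rw [pow_succ]; omega

lemma main_half {adj : V → V → Prop} (hT : IsTournament adj) (k t N K d D : ℕ) (hk : 1 ≤ k)
    (ht : 2 ≤ t) (hN : N = 100 * k * t) (hKe : K = 2 * 10 ^ 7 * k ^ 6 * t ^ 3)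
    (X Y : Finset V) (hX : X.card = N) (hY : Y.card = N) (hXY : Disjoint X Y)
    (outd : ∀ v, K ≤ (oN adj v).card) (ind : ∀ v, K ≤ (oN (flip adj) v).card)
    (outd' : ∀ v, v ∉ X ∪ Y → d ≤ (oN adj v).card)
    (ind' : ∀ v, v ∉ X ∪ Y → D ≤ (oN (flip adj) v).card)
    (hXd : ∀ v ∈ X, (oN adj v).card ≤ d) (hYD : ∀ v ∈ Y, (oN (flip adj) v).card ≤ D)
    (Kd : K ≤ d) (dD : d ≤ D)
    (hconn : ∀ S : Finset V, S.card < K → StrConnOn adj (Set.univ \ (S : Set V))) :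
    ∃ Q : Fin t → Set V, (⋃ i, Q i) = Set.univ ∧ (Pairwise fun i j => Disjoint (Q i) (Q j)) ∧
      ∀ i, StrKConnOn adj k (Q i) := by
  have hkt : 2 ≤ k * t := by nlinarith
  have hN2 : N = 100 * (k * t) := by rw [hN]; ring
  have hN200 : 200 ≤ N := by omega
  set m := k ^ 5 * t ^ 2 with hm
  have hK1 : 4 * 10 ^ 7 * m ≤ K := by
    calc 4 * 10 ^ 7 * m = 2 * 10 ^ 7 * m * 2 := by ring
      _ ≤ 2 * 10 ^ 7 * m * (k * t) := Nat.mul_le_mul_left _ hkt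
      _ = K := by rw [hKe, hm]; ring
  have ht1 : 1 ≤ t := by omega
  have kp : ∀ i j, i ≤ j → k ^ i ≤ k ^ j := fun i j h => Nat.pow_le_pow_right hk h
  have tp : ∀ i j, i ≤ j → t ^ i ≤ t ^ j := fun i j h => Nat.pow_le_pow_right ht1 h
  have mono : ∀ i j, i ≤ 5 → j ≤ 2 → k ^ i * t ^ j ≤ m := fun i j hi hj =>
    Nat.mul_le_mul (kp _ _ hi) (tp _ _ hj)
  have m1 : k ≤ m := by simpa using mono 1 0 (by norm_num) (by norm_num)
  have m2 : k * t ≤ m := by simpa using mono 1 1 (by norm_num) (by norm_num)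
  have m3 : k ^ 2 * t ≤ m := by simpa using mono 2 1 (by norm_num) (by norm_num)
  have m4 : k ^ 3 * t ≤ m := by simpa using mono 3 1 (by norm_num) (by norm_num)
  have m5 : k ^ 3 * t ^ 2 ≤ m := mono 3 2 (by norm_num) (by norm_num)
  have e1 : N * (2 * k + k ^ 2) ≤ 300 * m := by
    calc N * (2 * k + k ^ 2) = 200 * (k ^ 2 * t) + 100 * (k ^ 3 * t) := by rw [hN]; ring
      _ ≤ _ := by omega
  have e2 : (2 * k + 6) * N ≤ 800 * m := by
    calc (2 * k + 6) * N = 200 * (k ^ 2 * t) + 600 * (k * t) := by rw [hN]; ring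
      _ ≤ _ := by omega
  have e3 : (N + 1) * (N + 1) * k ≤ 40000 * m := by
    calc (N + 1) * (N + 1) * k ≤ (2 * N) * (2 * N) * k :=
          Nat.mul_le_mul_right _ (Nat.mul_le_mul (by omega) (by omega))
      _ = 40000 * (k ^ 3 * t ^ 2) := by rw [hN]; ring
      _ ≤ _ := by omega
  obtain ⟨A, B, a, b, Em, Ep, W0, h, hW0⟩ := step1 hT k N K d D N hk (by omega)
    (two_pow_big N (by omega)) X Y hX hY hXY outd ind outd' ind' hXd hYD Kd dD
  have hw : W0.card + W0.card * (8 * k ^ 3) ≤ 360000 * m := by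
    have hk3 : 1 ≤ k ^ 3 := Nat.one_le_pow _ _ hk
    calc W0.card + W0.card * (8 * k ^ 3) = W0.card * (1 + 8 * k ^ 3) := by ring
      _ ≤ (2 * N * (2 * N)) * (9 * k ^ 3) := Nat.mul_le_mul
          (hW0.trans (Nat.mul_le_mul_left _ (by omega))) (by omega)
      _ = 360000 * m := by rw [hN, hm]; ring
  obtain ⟨RA, RB, Fp, Fm, W, h2, hW⟩ := step2 h (by omega)
  obtain ⟨P, σ, x, y, h3⟩ := step3 h h2 (by omega) hconn
  obtain ⟨Gr, hs, h5⟩ := step5 h W h2.W0W P h3.disj x y (by omega)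
  refine assemble hk ht1 hN h h2 h3 h5 (50000 * m) ?_ (by omega) (by omega)
  apply le_of_eq
  rw [hN, hKe, hm]; ring

lemma degs {adj : V → V → Prop} (hT : IsTournament adj) (K : ℕ) (hcard : K < Fintype.card V)
    (hconn : ∀ S : Finset V, S.card < K → StrConnOn adj (Set.univ \ (S : Set V))) (v : V) :
    K ≤ (oN adj v).card := by
  by_contra hlt
  push Not at hlt
  have hv : v ∉ oN adj v := fun h => hT.1 v ((mem_oN _ _ _).1 h)
  have : ∃ w, w ∉ insert v (oN adj v) := by
    by_contra hcon
    push Not at hcon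
    have h1 : (insert v (oN adj v)) = Finset.univ := Finset.eq_univ_iff_forall.2 hcon
    have h2 := Finset.card_insert_le v (oN adj v)
    rw [h1, Finset.card_univ] at h2
    omega
  obtain ⟨w, hw⟩ := this
  rw [Finset.mem_insert, not_or] at hw
  have hr := hconn (oN adj v) hlt v ⟨trivial, by simpa using hv⟩ w ⟨trivial, by simpa using hw.2⟩
  unfold ReachIn at hr
  rcases Relation.ReflTransGen.cases_head hr with e | ⟨c, hc, _⟩
  · exact hw.1 e.symm
  · exact hc.2.1.2 (by simpa using (mem_oN adj c v).2 hc.2.2)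

lemma conn_flip {adj : V → V → Prop} {U : Set V} (h : StrConnOn adj U) : StrConnOn (flip adj) U :=
  fun x hx y hy => reach_flip (adj := flip adj) (h y hy x hx)

lemma main {adj : V → V → Prop} (hT : IsTournament adj) (k t K : ℕ) (hk : 1 ≤ k)
    (ht : 2 ≤ t) (hKe : K = 2 * 10 ^ 7 * k ^ 6 * t ^ 3) (hcard : K < Fintype.card V)
    (hconn : ∀ S : Finset V, S.card < K → StrConnOn adj (Set.univ \ (S : Set V))) :
    ∃ Q : Fin t → Set V, (⋃ i, Q i) = Set.univ ∧ (Pairwise fun i j => Disjoint (Q i) (Q j)) ∧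
      ∀ i, StrKConnOn adj k (Q i) := by
  obtain ⟨N, hN⟩ : ∃ N, N = 100 * k * t := ⟨_, rfl⟩
  have hN0 : 0 < N := by rw [hN]; positivity
  have hNK : 2 * N ≤ K := by
    have h1 : k ^ 1 * t ^ 1 ≤ k ^ 6 * t ^ 3 := Nat.mul_le_mul (Nat.pow_le_pow_right hk (by norm_num))
      (Nat.pow_le_pow_right (by omega) (by norm_num))
    have e1 : N = 100 * (k ^ 1 * t ^ 1) := by rw [hN]; ring
    have e2 : K = 2 * 10 ^ 7 * (k ^ 6 * t ^ 3) := by rw [hKe]; ring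
    omega
  have hconn' : ∀ S : Finset V, S.card < K → StrConnOn (flip adj) (Set.univ \ (S : Set V)) :=
    fun S hS => conn_flip (hconn S hS)
  have outd := degs hT K hcard hconn
  have ind := degs (flipT hT) K hcard hconn'
  obtain ⟨X, _, d, hX, Kd, hXd, hd⟩ := smallest' (fun v => (oN adj v).card) Finset.univ N K
    (by rw [Finset.card_univ]; omega) hN0 outd
  obtain ⟨Y, hYs, D, hY, KD, hYD, hD⟩ := smallest' (fun v => (oN (flip adj) v).card)
    (Finset.univ \ X) N K
    (by rw [Finset.card_sdiff_of_subset (Finset.subset_univ _), Finset.card_univ]; omega) hN0 ind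
  have hXY : Disjoint X Y := by
    rw [Finset.disjoint_left]; intro v h1 h2; exact (Finset.mem_sdiff.1 (hYs h2)).2 h1
  have outd' : ∀ v, v ∉ X ∪ Y → d ≤ (oN adj v).card := by
    intro v hv; rw [Finset.mem_union, not_or] at hv
    exact hd v (by simp [hv.1])
  have ind' : ∀ v, v ∉ X ∪ Y → D ≤ (oN (flip adj) v).card := by
    intro v hv; rw [Finset.mem_union, not_or] at hv
    exact hD v (by simp [hv.1, hv.2])
  rcases le_total d D with h | h
  · exact main_half hT k t N K d D hk ht hN hKe X Y hX hY hXY outd ind outd' ind' hXd hYD Kd h hconn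
  · obtain ⟨Q, q1, q2, q3⟩ := main_half (flipT hT) k t N K D d hk ht hN hKe Y X hY hX hXY.symm
      ind outd (fun v hv => ind' v (by rwa [Finset.union_comm]))
      (fun v hv => outd' v (by rwa [Finset.union_comm])) hYD hXd KD h hconn'
    exact ⟨Q, q1, q2, fun i => ⟨(q3 i).1, fun S h1 h2 => conn_flip (adj := flip adj)
      ((q3 i).2 S h1 h2)⟩⟩

end
end TP

/-- Every strongly `10^7 k^6 t^3 log(k t^2)`-connected tournament admits
a partition of its vertex set into `t` classes each inducing a strongly `k`-connected
subtournament. -/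
theorem stmt0 [Fintype V] (adj : V → V → Prop) (hT : IsTournament adj)
    (k t : ℕ) (hk : 1 ≤ k) (ht : 2 ≤ t)
    (hconn : StrConnR adj
      (10 ^ 7 * (k : ℝ) ^ 6 * (t : ℝ) ^ 3 * Real.logb 2 ((k : ℝ) * (t : ℝ) ^ 2))) :
    ∃ P : Fin t → Set V,
      (⋃ i, P i) = Set.univ ∧
      (Pairwise fun i j => Disjoint (P i) (P j)) ∧
      ∀ i, StrKConnOn adj k (P i) := by
  obtain ⟨h1, h2⟩ := hconn
  have hlog : 2 ≤ Real.logb 2 ((k : ℝ) * (t : ℝ) ^ 2) := by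
    have hk' : (1 : ℝ) ≤ k := by exact_mod_cast hk
    have ht' : (2 : ℝ) ≤ t := by exact_mod_cast ht
    have h4 : (2 : ℝ) ^ (2 : ℝ) ≤ (k : ℝ) * (t : ℝ) ^ 2 := by
      have : (4 : ℝ) ≤ (t : ℝ) ^ 2 := by nlinarith
      norm_num
      nlinarith
    rw [Real.le_logb_iff_rpow_le (by norm_num) (by positivity)]
    exact h4
  have hK : ((2 * 10 ^ 7 * k ^ 6 * t ^ 3 : ℕ) : ℝ) ≤
      10 ^ 7 * (k : ℝ) ^ 6 * (t : ℝ) ^ 3 * Real.logb 2 ((k : ℝ) * (t : ℝ) ^ 2) := by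
    have hp : (0 : ℝ) ≤ 10 ^ 7 * (k : ℝ) ^ 6 * (t : ℝ) ^ 3 := by positivity
    have := mul_le_mul_of_nonneg_left hlog hp
    push_cast
    linarith
  refine TP.main hT k t _ hk ht rfl ?_ ?_
  · exact_mod_cast hK.trans_lt h1
  · intro S hS
    apply h2
    rw [Set.ncard_coe_finset]
    have : (S.card : ℝ) < ((2 * 10 ^ 7 * k ^ 6 * t ^ 3 : ℕ) : ℝ) := by exact_mod_cast hS
    exact this.trans_le hK
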